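/- Let k, N be integers with 0 ≤ k ≤ N−3 and set 2*_{N,k} := 2(N−k)/(N−k−2). Let 0 < r < ρ, let Θ be the open ball in ℝ^{N−k} of radius r centered at (ρ,0,…,0), and let Ω := {(y,z) ∈ ℝ^{k+1}×ℝ^{N−k−1} : (|y|,z) ∈ Θ}. Let λ₁(Ω) := inf{ (∫_Ω |∇w|²dx)/(∫_Ω w²dx) : w ∈ C_c^∞(Ω), w ≠ 0 }. Let p ≥ 2*_{N,k} and let λ ∈ ℝ satisfy λ ≤ (2(p − 2*_{N,k})/(2*_{N,k}·(p−2)))·λ₁(Ω). Then every function u : closure(Ω) → ℝ that is twice continuously differentiable in Ω, continuously differentiable on closure(Ω) (i.e. u and ∇u extend continuously to closure(Ω)), satisfies −Δu(x) = λ·u(x) + |u(x)|^{p−2}·u(x) for all x ∈ Ω, and satisfies u = 0 on the boundary ∂Ω, is identically zero on Ω. -/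

import Mathlib

open MeasureTheory

noncomputable section

/-- `u ∈ C_c^∞(s)`: `u` is smooth with compact support contained in `s`. -/
def IsTestFun {E : Type*} [NormedAddCommGroup E] [NormedSpace ℝ E]
    (s : Set E) (u : E → ℝ) : Prop :=
  ContDiff ℝ (⊤ : ℕ∞) u ∧ HasCompactSupport u ∧ tsupport u ⊆ s

/-- The Laplacian (sum of second partial derivatives with respect to the standard
coordinates) of a function on `ℝ^N = ℝ^{k+1} × ℝ^{N−k−1}`. -/
def lap (k N : ℕ)
    (u : EuclideanSpace ℝ (Fin (k + 1)) × EuclideanSpace ℝ (Fin (N - k - 1)) → ℝ)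
    (x : EuclideanSpace ℝ (Fin (k + 1)) × EuclideanSpace ℝ (Fin (N - k - 1))) : ℝ :=
  (∑ i : Fin (k + 1),
      fderiv ℝ (fun x' => fderiv ℝ u x' (EuclideanSpace.single i 1, 0)) x
        (EuclideanSpace.single i 1, 0)) +
    ∑ j : Fin (N - k - 1),
      fderiv ℝ (fun x' => fderiv ℝ u x' (0, EuclideanSpace.single j 1)) x
        (0, EuclideanSpace.single j 1)

/-- `|∇w(x)|²`, the sum of the squares of the partial derivatives of `w` with respect to
the standard coordinates of `ℝ^N = ℝ^{k+1} × ℝ^{N−k−1}`. -/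
def gradSq (k N : ℕ)
    (w : EuclideanSpace ℝ (Fin (k + 1)) × EuclideanSpace ℝ (Fin (N - k - 1)) → ℝ)
    (x : EuclideanSpace ℝ (Fin (k + 1)) × EuclideanSpace ℝ (Fin (N - k - 1))) : ℝ :=
  (∑ i : Fin (k + 1), fderiv ℝ w x (EuclideanSpace.single i 1, 0) ^ 2) +
    ∑ j : Fin (N - k - 1), fderiv ℝ w x (0, EuclideanSpace.single j 1) ^ 2

open MeasureTheory

noncomputable section
set_option linter.unusedSectionVars false
namespace PZ
open Filter Topology Set

section gen
variable {E : Type*} [NormedAddCommGroup E] [NormedSpace ℝ E] [FiniteDimensional ℝ E]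
  [MeasurableSpace E] [BorelSpace E] {μ : Measure E} [μ.IsAddHaarMeasure]

lemma cont_cut {Ω : Set E} (hΩ : IsOpen Ω) {η q : E → ℝ} (hη : Continuous η)
    (hs : tsupport η ⊆ Ω) (hq : ContinuousOn q Ω) :
    Continuous (fun x => η x * q x) := by
  apply continuous_of_tsupport
  intro x hx
  have hx' : x ∈ Ω := hs (closure_mono (Function.support_mul_subset_left η q) hx)
  exact hη.continuousAt.mul (hq.continuousAt (hΩ.mem_nhds hx'))

lemma integrable_cut {Ω : Set E} (hΩ : IsOpen Ω) {η q : E → ℝ} (hη : Continuous η)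
    (hc : HasCompactSupport η) (hs : tsupport η ⊆ Ω) (hq : ContinuousOn q Ω) :
    Integrable (fun x => η x * q x) μ :=
  (cont_cut hΩ hη hs hq).integrable_of_hasCompactSupport hc.mul_right

lemma ibp {Ω : Set E} (hΩ : IsOpen Ω) {η X : E → ℝ} (hη : ContDiff ℝ 1 η)
    (hc : HasCompactSupport η) (hs : tsupport η ⊆ Ω) (hX : ContDiffOn ℝ 1 X Ω) (v : E) :
    ∫ x in Ω, η x * fderiv ℝ X x v ∂μ = - ∫ x in Ω, fderiv ℝ η x v * X x ∂μ := by
  have hd : ContinuousOn (fun x => fderiv ℝ X x v) Ω :=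
    (hX.continuousOn_fderiv_of_isOpen hΩ le_rfl).clm_apply continuousOn_const
  have h0 : ∀ x, x ∉ Ω → η x = 0 := fun x hx => image_eq_zero_of_notMem_tsupport (fun h => hx (hs h))
  have hts : tsupport (fun x => fderiv ℝ η x v) ⊆ tsupport η := tsupport_fderiv_apply_subset ℝ v
  have h1 : ∀ x, x ∉ Ω → fderiv ℝ η x v = 0 := fun x hx =>
    image_eq_zero_of_notMem_tsupport (f := fun x => fderiv ℝ η x v) (fun h => hx (hs (hts h)))
  rw [setIntegral_eq_integral_of_forall_compl_eq_zero (fun x hx => by rw [h0 x hx, zero_mul]),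
    setIntegral_eq_integral_of_forall_compl_eq_zero (fun x hx => by rw [h1 x hx, zero_mul])]
  have hcv : Continuous (fun x => fderiv ℝ η x v) :=
    (hη.continuous_fderiv one_ne_zero).clm_apply continuous_const
  apply integral_mul_fderiv_eq_neg_fderiv_mul_of_integrable
  · exact integrable_cut hΩ hcv (hc.fderiv_apply ℝ v) (hts.trans hs) hX.continuousOn
  · exact integrable_cut hΩ hη.continuous hc hs hd
  · exact integrable_cut hΩ hη.continuous hc hs hX.continuousOn
  · intro x _; exact (hη.differentiable one_ne_zero) x
  · intro x hx
    exact (hX.contDiffAt (hΩ.mem_nhds (hs hx))).differentiableAt one_ne_zero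

/-- cutoff families -/
structure Cut (μ : Measure E) (Ω : Set E) (D : E → ℝ) (η m : ℝ → E → ℝ) : Prop where
  isOpen : IsOpen Ω
  fin : μ Ω < ⊤
  pos : ∀ x ∈ Ω, 0 < D x
  smooth : ∀ ε > 0, ContDiff ℝ 1 (η ε)
  cpt : ∀ ε > 0, HasCompactSupport (η ε)
  supp : ∀ ε > 0, tsupport (η ε) ⊆ Ω
  nonneg : ∀ ε x, 0 ≤ η ε x
  le_one : ∀ ε x, η ε x ≤ 1
  tends : ∀ x ∈ Ω, Tendsto (fun ε => η ε x) (𝓝[>] 0) (𝓝 1)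
  deriv : ∀ ε > 0, ∀ x ∈ Ω, fderiv ℝ (η ε) x = m ε x • fderiv ℝ D x
  m_nonneg : ∀ ε > 0, ∀ x, 0 ≤ m ε x
  m_supp : ∀ ε > 0, ∀ x, 2 * ε ≤ D x → m ε x = 0
  m_cont : ∀ ε > 0, ContinuousOn (m ε) Ω
  m_int : ∀ ε > 0, IntegrableOn (m ε) Ω μ
  mD : ∃ K, ∀ ε > 0, ∀ x ∈ Ω, m ε x * D x ≤ K
  m_tot : ∃ C, 0 ≤ C ∧ ∀ᶠ ε in 𝓝[>] (0:ℝ), ∫ x in Ω, m ε x ∂μ ≤ C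

/-- bounded and continuous on Ω -/
def BC (Ω : Set E) (q : E → ℝ) : Prop := ContinuousOn q Ω ∧ ∃ K, ∀ x ∈ Ω, |q x| ≤ K

section
variable {Ω : Set E} {q s : E → ℝ}
lemma BC.add (h : BC Ω q) (h' : BC Ω s) : BC Ω (fun x => q x + s x) := by
  obtain ⟨h1, K, h2⟩ := h
  obtain ⟨h3, L, h4⟩ := h'
  exact ⟨h1.add h3, K + L, fun x hx => (abs_add_le _ _).trans (add_le_add (h2 x hx) (h4 x hx))⟩
lemma BC.mul (h : BC Ω q) (h' : BC Ω s) : BC Ω (fun x => q x * s x) := by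
  obtain ⟨h1, K, h2⟩ := h
  obtain ⟨h3, L, h4⟩ := h'
  refine ⟨h1.mul h3, K * L, fun x hx => ?_⟩
  rw [abs_mul]
  exact mul_le_mul (h2 x hx) (h4 x hx) (abs_nonneg _) ((abs_nonneg _).trans (h2 x hx))
lemma BC.const (c : ℝ) : BC Ω (fun _ => c) := ⟨continuousOn_const, |c|, fun _ _ => le_rfl⟩
lemma BC.neg (h : BC Ω q) : BC Ω (fun x => - q x) := by
  obtain ⟨h1, K, h2⟩ := h
  exact ⟨h1.neg, K, fun x hx => by rw [abs_neg]; exact h2 x hx⟩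
lemma BC.sub (h : BC Ω q) (h' : BC Ω s) : BC Ω (fun x => q x - s x) := by
  simpa [sub_eq_add_neg] using h.add h'.neg
lemma BC.sum {ι : Type*} (t : Finset ι) {f : ι → E → ℝ} (h : ∀ i, BC Ω (f i)) :
    BC Ω (fun x => ∑ i ∈ t, f i x) := by
  classical
  induction t using Finset.induction_on with
  | empty => simpa using BC.const 0
  | insert a t ha ih => simpa [Finset.sum_insert ha] using (h a).add ih
lemma BC.pow (h : BC Ω q) (n : ℕ) : BC Ω (fun x => q x ^ n) := by
  induction n with
  | zero => simpa using BC.const 1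
  | succ n ih => simpa [pow_succ] using ih.mul h
lemma BC.abs (h : BC Ω q) : BC Ω (fun x => |q x|) := by
  obtain ⟨h1, K, h2⟩ := h
  exact ⟨h1.abs, K, fun x hx => by rw [abs_abs]; exact h2 x hx⟩
lemma BC.comp (h : BC Ω q) {φ : ℝ → ℝ} (hφ : Continuous φ) : BC Ω (fun x => φ (q x)) := by
  obtain ⟨h1, K, h2⟩ := h
  obtain ⟨L, hL⟩ := (isCompact_Icc (a := -K) (b := K)).exists_bound_of_continuousOn hφ.continuousOn
  exact ⟨hφ.comp_continuousOn h1, L, fun x hx => hL _ (abs_le.mp (h2 x hx))⟩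
lemma BC.congr (h : BC Ω q) (he : ∀ x ∈ Ω, s x = q x) : BC Ω s := by
  obtain ⟨h1, K, h2⟩ := h
  exact ⟨h1.congr he, K, fun x hx => by rw [he x hx]; exact h2 x hx⟩
lemma BC.of_closure (hΩ : IsCompact (closure Ω)) (h : ContinuousOn q (closure Ω)) : BC Ω q := by
  obtain ⟨L, hL⟩ := hΩ.exists_bound_of_continuousOn h
  exact ⟨h.mono subset_closure, L, fun x hx => hL x (subset_closure hx)⟩
end

lemma BC.integrableOn {Ω : Set E} {q : E → ℝ} (h : BC Ω q) (ho : IsOpen Ω) (hf : μ Ω < ⊤) :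
    IntegrableOn q Ω μ := by
  obtain ⟨h1, K, h2⟩ := h
  exact IntegrableOn.of_bound hf (h1.aestronglyMeasurable ho.measurableSet) K
    ((ae_restrict_iff' ho.measurableSet).2 (ae_of_all _ h2))

namespace Cut
variable {Ω : Set E} {D : E → ℝ} {η m : ℝ → E → ℝ} {ι : Type*} [Fintype ι] {e : ι → E}

lemma lim_cut (h : Cut μ Ω D η m) {q : E → ℝ} (hq : IntegrableOn q Ω μ) :
    Tendsto (fun ε => ∫ x in Ω, η ε x * q x ∂μ) (𝓝[>] 0) (𝓝 (∫ x in Ω, q x ∂μ)) := by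
  apply tendsto_integral_filter_of_dominated_convergence (fun x => ‖q x‖)
  · filter_upwards [self_mem_nhdsWithin] with ε hε
    exact ((h.smooth ε hε).continuous.aestronglyMeasurable).mul hq.aestronglyMeasurable
  · filter_upwards [self_mem_nhdsWithin] with ε hε
    refine ae_of_all _ fun x => ?_
    rw [norm_mul, Real.norm_of_nonneg (h.nonneg ε x)]
    exact mul_le_of_le_one_left (norm_nonneg _) (h.le_one ε x)
  · exact hq.norm
  · refine (ae_restrict_iff' h.isOpen.measurableSet).2 (ae_of_all _ fun x hx => ?_)
    simpa using (h.tends x hx).mul_const (q x)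

lemma m_mul_int (h : Cut μ Ω D η m) {q : E → ℝ} (hq : BC Ω q) {ε : ℝ} (hε : 0 < ε) :
    IntegrableOn (fun x => m ε x * q x) Ω μ := by
  obtain ⟨h1, K, h2⟩ := hq
  exact (h.m_int ε hε).mul_bdd (c := K) (h1.aestronglyMeasurable h.isOpen.measurableSet)
    ((ae_restrict_iff' h.isOpen.measurableSet).2 (ae_of_all _ h2))

lemma div_cut (h : Cut μ Ω D η m) {X : ι → E → ℝ} (hX : ∀ i, ContDiffOn ℝ 1 (X i) Ω)
    {ε : ℝ} (hε : 0 < ε) :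
    ∫ x in Ω, η ε x * ∑ i, fderiv ℝ (X i) x (e i) ∂μ =
      - ∫ x in Ω, m ε x * ∑ i, fderiv ℝ D x (e i) * X i x ∂μ := by
  have e1 : ∀ x, η ε x * ∑ i, fderiv ℝ (X i) x (e i) = ∑ i, η ε x * fderiv ℝ (X i) x (e i) :=
    fun x => Finset.mul_sum _ _ _
  have e2 : ∀ x ∈ Ω, m ε x * ∑ i, fderiv ℝ D x (e i) * X i x =
      ∑ i, fderiv ℝ (η ε) x (e i) * X i x := by
    intro x hx
    rw [Finset.mul_sum]
    refine Finset.sum_congr rfl fun i _ => ?_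
    rw [h.deriv ε hε x hx]; simp [mul_assoc]
  rw [setIntegral_congr_fun h.isOpen.measurableSet e2]
  simp_rw [e1]
  rw [integral_finsetSum, integral_finsetSum, ← Finset.sum_neg_distrib]
  · exact Finset.sum_congr rfl fun i _ => ibp h.isOpen (h.smooth ε hε) (h.cpt ε hε) (h.supp ε hε) (hX i) (e i)
  · intro i _
    refine Integrable.integrableOn ?_
    refine integrable_cut h.isOpen
      (((h.smooth ε hε).continuous_fderiv one_ne_zero).clm_apply continuous_const)
      ((h.cpt ε hε).fderiv_apply ℝ _) ((tsupport_fderiv_apply_subset ℝ _).trans (h.supp ε hε))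
      (hX i).continuousOn
  · intro i _
    refine Integrable.integrableOn ?_
    exact integrable_cut h.isOpen (h.smooth ε hε).continuous (h.cpt ε hε) (h.supp ε hε)
      (((hX i).continuousOn_fderiv_of_isOpen h.isOpen le_rfl).clm_apply continuousOn_const)

lemma m_small (h : Cut μ Ω D η m) {q : E → ℝ} (hq : BC Ω q)
    (hs : ∀ δ > 0, ∃ ε₀ > 0, ∀ x ∈ Ω, D x < ε₀ → q x ≤ δ) {δ : ℝ} (hδ : 0 < δ) :
    ∀ᶠ ε in 𝓝[>] (0:ℝ), ∫ x in Ω, m ε x * q x ∂μ ≤ δ := by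
  obtain ⟨C, hC0, hC⟩ := h.m_tot
  obtain ⟨ε₀, hε₀, hs⟩ := hs (δ / (C + 1)) (by positivity)
  filter_upwards [self_mem_nhdsWithin, hC,
    mem_nhdsWithin_of_mem_nhds (Iio_mem_nhds (show (0:ℝ) < ε₀ / 2 by positivity))] with ε hε hCε hlt
  have hlt' : 2 * ε < ε₀ := by have : ε < ε₀ / 2 := hlt; linarith
  calc ∫ x in Ω, m ε x * q x ∂μ ≤ ∫ x in Ω, m ε x * (δ / (C + 1)) ∂μ := by
        refine setIntegral_mono_on (h.m_mul_int hq hε) ((h.m_int ε hε).mul_const _)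
          h.isOpen.measurableSet fun x hx => ?_
        by_cases hd : D x < ε₀
        · exact mul_le_mul_of_nonneg_left (hs x hx hd) (h.m_nonneg ε hε x)
        · rw [h.m_supp ε hε x (by linarith)]; simp
    _ = (∫ x in Ω, m ε x ∂μ) * (δ / (C + 1)) := integral_mul_const _ _
    _ ≤ C * (δ / (C + 1)) := by gcongr
    _ ≤ δ := by
        rw [mul_div_assoc', div_le_iff₀ (by positivity)]; nlinarith

lemma m_tendsto (h : Cut μ Ω D η m) {q : E → ℝ} (hq : BC Ω q) (h0 : ∀ x ∈ Ω, 0 ≤ q x)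
    (hs : ∀ δ > 0, ∃ ε₀ > 0, ∀ x ∈ Ω, D x < ε₀ → q x ≤ δ) :
    Tendsto (fun ε => ∫ x in Ω, m ε x * q x ∂μ) (𝓝[>] 0) (𝓝 0) := by
  rw [Metric.tendsto_nhds]
  intro δ hδ
  filter_upwards [self_mem_nhdsWithin, h.m_small hq hs (half_pos hδ)] with ε hε h1
  have : 0 ≤ ∫ x in Ω, m ε x * q x ∂μ := setIntegral_nonneg h.isOpen.measurableSet
    fun x hx => mul_nonneg (h.m_nonneg ε hε x) (h0 x hx)
  rw [Real.dist_eq, sub_zero, abs_of_nonneg this]; linarith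

lemma div_lim (h : Cut μ Ω D η m) {X : ι → E → ℝ} (hX : ∀ i, ContDiffOn ℝ 1 (X i) Ω)
    (hdiv : IntegrableOn (fun x => ∑ i, fderiv ℝ (X i) x (e i)) Ω μ) {q : E → ℝ} (hq : BC Ω q)
    (hDX : BC Ω (fun x => ∑ i, fderiv ℝ D x (e i) * X i x))
    (hs : ∀ δ > 0, ∃ ε₀ > 0, ∀ x ∈ Ω, D x < ε₀ → ∑ i, fderiv ℝ D x (e i) * X i x + q x ≤ δ)
    {δ : ℝ} (hδ : 0 < δ) :
    ∀ᶠ ε in 𝓝[>] (0:ℝ), ∫ x in Ω, m ε x * q x ∂μ ≤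
      ∫ x in Ω, ∑ i, fderiv ℝ (X i) x (e i) ∂μ + δ := by
  filter_upwards [self_mem_nhdsWithin, h.m_small (hDX.add hq) hs (half_pos hδ),
    (h.lim_cut hdiv).eventually (gt_mem_nhds (lt_add_of_pos_right _ (half_pos hδ)))] with ε hε h1 h2
  rw [h.div_cut hX hε] at h2
  simp_rw [mul_add] at h1
  rw [integral_add (h.m_mul_int hDX hε) (h.m_mul_int hq hε)] at h1
  linarith

lemma div_zero (h : Cut μ Ω D η m) {X : ι → E → ℝ} (hX : ∀ i, ContDiffOn ℝ 1 (X i) Ω)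
    (hdiv : IntegrableOn (fun x => ∑ i, fderiv ℝ (X i) x (e i)) Ω μ) {q : E → ℝ} (hq : BC Ω q)
    (hDX : ∀ x ∈ Ω, |∑ i, fderiv ℝ D x (e i) * X i x| ≤ q x)
    (ht : Tendsto (fun ε => ∫ x in Ω, m ε x * q x ∂μ) (𝓝[>] 0) (𝓝 0)) :
    ∫ x in Ω, ∑ i, fderiv ℝ (X i) x (e i) ∂μ = 0 := by
  refine tendsto_nhds_unique (h.lim_cut hdiv) ?_
  refine squeeze_zero_norm' ?_ ht
  filter_upwards [self_mem_nhdsWithin] with ε hε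
  rw [h.div_cut hX hε, norm_neg]
  refine norm_integral_le_of_norm_le (h.m_mul_int hq hε) ?_
  refine (ae_restrict_iff' h.isOpen.measurableSet).2 (ae_of_all _ fun x hx => ?_)
  rw [norm_mul, Real.norm_of_nonneg (h.m_nonneg ε hε x)]
  exact mul_le_mul_of_nonneg_left (hDX x hx) (h.m_nonneg ε hε x)
end Cut

lemma symm2 {v : E → ℝ} {x : E} (hv : ContDiffAt ℝ 2 v x) (a b : E) :
    fderiv ℝ (fun y => fderiv ℝ v y a) x b = fderiv ℝ (fun y => fderiv ℝ v y b) x a := by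
  have hd : DifferentiableAt ℝ (fderiv ℝ v) x :=
    (hv.fderiv_right (m := 1) (by norm_num)).differentiableAt one_ne_zero
  have hs := (hv.isSymmSndFDerivAt (by simp)) a b
  rw [fderiv_clm_apply hd (differentiableAt_const _), fderiv_clm_apply hd (differentiableAt_const _)]
  simpa using hs.symm

lemma poh_div {ι : Type*} [Fintype ι] {e : ι → E} {v : E → ℝ} {x : E} (hv : ContDiffAt ℝ 2 v x)
    {V : ι → E → ℝ} (hV : ∀ i, DifferentiableAt ℝ (V i) x) :
    ∑ i, fderiv ℝ (fun y => (∑ j, V j y * fderiv ℝ v y (e j)) * fderiv ℝ v y (e i)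
      - 1 / 2 * (∑ j, fderiv ℝ v y (e j) ^ 2) * V i y) x (e i) =
    (∑ j, V j x * fderiv ℝ v x (e j)) * ∑ i, fderiv ℝ (fun y => fderiv ℝ v y (e i)) x (e i)
      + ∑ i, ∑ j, fderiv ℝ (V j) x (e i) * (fderiv ℝ v x (e i) * fderiv ℝ v x (e j))
      - 1 / 2 * (∑ i, fderiv ℝ (V i) x (e i)) * ∑ j, fderiv ℝ v x (e j) ^ 2 := by
  have hd : DifferentiableAt ℝ (fderiv ℝ v) x :=
    (hv.fderiv_right (m := 1) (by norm_num)).differentiableAt one_ne_zero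
  have hP : ∀ i, HasFDerivAt (fun y => fderiv ℝ v y (e i)) (fderiv ℝ (fun y => fderiv ℝ v y (e i)) x) x :=
    fun i => (hd.clm_apply (differentiableAt_const _)).hasFDerivAt
  have hsym : ∀ i j, fderiv ℝ (fun y => fderiv ℝ v y (e i)) x (e j) =
    fderiv ℝ (fun y => fderiv ℝ v y (e j)) x (e i) := fun i j => symm2 hv _ _
  generalize hPP : (fun i y => fderiv ℝ v y (e i)) = P at *
  have hP0 : ∀ i y, fderiv ℝ v y (e i) = P i y := fun i y => by rw [← hPP]
  have hP1 : ∀ i, (fun y => fderiv ℝ v y (e i)) = P i := fun i => by rw [← hPP]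
  simp only [hP1] at hP hsym
  simp only [hP1, hP0]
  have key : ∀ i, fderiv ℝ (fun y => (∑ j, V j y * P j y) * P i y
      - 1 / 2 * (∑ j, P j y ^ 2) * V i y) x (e i) =
      (∑ j, (fderiv ℝ (V j) x (e i) * P j x + V j x * fderiv ℝ (P j) x (e i))) * P i x +
      (∑ j, V j x * P j x) * fderiv ℝ (P i) x (e i)
      - (∑ j, P j x * fderiv ℝ (P j) x (e i)) * V i x
      - 1 / 2 * (∑ j, P j x ^ 2) * fderiv ℝ (V i) x (e i) := by
    intro i
    have h1 : HasFDerivAt (fun y => ∑ j, V j y * P j y) _ x :=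
      HasFDerivAt.fun_sum fun j (_ : j ∈ Finset.univ) => (hV j).hasFDerivAt.mul (hP j)
    have h2 : HasFDerivAt (fun y => ∑ j, P j y ^ 2) _ x :=
      HasFDerivAt.fun_sum fun j (_ : j ∈ Finset.univ) => (hP j).pow 2
    have h3 := (h1.mul (hP i)).sub ((h2.const_mul (1/2)).mul (hV i).hasFDerivAt)
    have h4 := h3.fderiv
    refine (congrArg (fun L => L (e i)) h4).trans ?_
    simp only [ContinuousLinearMap.sub_apply, ContinuousLinearMap.add_apply,
      ContinuousLinearMap.smul_apply, ContinuousLinearMap.sum_apply, smul_eq_mul, nsmul_eq_mul]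
    have : ∑ j, (2:ℕ) • (P j x ^ (2 - 1) * fderiv ℝ (P j) x (e i)) = 2 * ∑ j, P j x * fderiv ℝ (P j) x (e i) := by
      rw [Finset.mul_sum]; refine Finset.sum_congr rfl fun j _ => ?_
      simp
    have e3 : (∑ j, (V j x * fderiv ℝ (P j) x (e i) + P j x * fderiv ℝ (V j) x (e i))) =
      ∑ j, (fderiv ℝ (V j) x (e i) * P j x + V j x * fderiv ℝ (P j) x (e i)) :=
      Finset.sum_congr rfl fun j _ => by ring
    have e4 : (∑ j, ((2:ℕ):ℝ) * P j x ^ (2 - 1) * fderiv ℝ (P j) x (e i)) = 2 * ∑ j, P j x * fderiv ℝ (P j) x (e i) := by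
      rw [Finset.mul_sum]; refine Finset.sum_congr rfl fun j _ => ?_
      norm_num; ring
    simp only [e3]
    try simp only [this]
    try simp only [e4]
    ring
  rw [Finset.sum_congr rfl fun i _ => key i]
  simp only [Finset.sum_sub_distrib, Finset.sum_add_distrib, add_mul, Finset.sum_mul, Finset.mul_sum]
  have s1 : ∑ i, ∑ j, V j x * fderiv ℝ (P j) x (e i) * P i x =
      ∑ i, ∑ j, P j x * fderiv ℝ (P j) x (e i) * V i x := by
    rw [Finset.sum_comm]
    refine Finset.sum_congr rfl fun i _ => Finset.sum_congr rfl fun j _ => ?_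
    rw [hsym i j]; ring
  have s2 : ∑ i, ∑ j, fderiv ℝ (V j) x (e i) * P j x * P i x =
      ∑ i, ∑ j, fderiv ℝ (V j) x (e i) * (P i x * P j x) :=
    Finset.sum_congr rfl fun i _ => Finset.sum_congr rfl fun j _ => by ring
  have s3 : ∑ i, ∑ j, V j x * P j x * fderiv ℝ (P i) x (e i) =
     ∑ i, ∑ j, V i x * P i x * fderiv ℝ (P j) x (e j) := by
    rw [Finset.sum_comm]
  have s4 : ∑ i, ∑ j, 1 / 2 * P j x ^ 2 * fderiv ℝ (V i) x (e i) =
     ∑ i, ∑ j, 1 / 2 * fderiv ℝ (V j) x (e j) * P i x ^ 2 := by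
    rw [Finset.sum_comm]
    refine Finset.sum_congr rfl fun i _ => Finset.sum_congr rfl fun j _ => by ring
  rw [s1, s2, s4, s3]
  ring_nf
end gen
end PZ
end

open MeasureTheory

noncomputable section
set_option linter.unusedSectionVars false
namespace PZ
open Filter Topology Set

section gen2
variable {E : Type*} [NormedAddCommGroup E] [NormedSpace ℝ E] [FiniteDimensional ℝ E]
  [MeasurableSpace E] [BorelSpace E] {μ : Measure E} [μ.IsAddHaarMeasure]

lemma mollify (μ : Measure E) [μ.IsAddHaarMeasure] {Ω : Set E} (hΩ : IsOpen Ω) {w : E → ℝ}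
    (hw : ContDiff ℝ 1 w) (hc : HasCompactSupport w) (hs : tsupport w ⊆ Ω) {δ : ℝ} (hδ : 0 < δ) :
    ∃ ψ : E → ℝ, ContDiff ℝ (⊤ : ℕ∞) ψ ∧ HasCompactSupport ψ ∧ tsupport ψ ⊆ Ω ∧
      (∀ x, |ψ x - w x| ≤ δ) ∧ ∀ x, ‖fderiv ℝ ψ x - fderiv ℝ w x‖ ≤ δ := by
  obtain ⟨κ, hκ, hκs⟩ := hc.isCompact.exists_cthickening_subset_open hΩ hs
  have u1 := Metric.uniformContinuous_iff.1 (hc.uniformContinuous_of_continuous hw.continuous) δ hδ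
  have hcd := hw.continuous_fderiv one_ne_zero
  have u2 := Metric.uniformContinuous_iff.1
    ((hc.fderiv ℝ).uniformContinuous_of_continuous hcd) δ hδ
  obtain ⟨a, ha, h1⟩ := u1
  obtain ⟨b, hb, h2⟩ := u2
  set R := min κ (min a b) with hR
  have hRp : 0 < R := by positivity
  let φ : ContDiffBump (0 : E) := ⟨R / 2, R, by positivity, by linarith⟩
  have hφR : φ.rOut = R := rfl
  have hli : LocallyIntegrable w μ := hw.continuous.locallyIntegrable
  have hφc : HasCompactSupport (φ.normed μ) := φ.hasCompactSupport_normed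
  set ψ := convolution (φ.normed μ) w (ContinuousLinearMap.lsmul ℝ ℝ) μ with hψ
  have hsupp : tsupport ψ ⊆ Metric.cthickening κ (tsupport w) := by
    apply closure_minimal _ Metric.isClosed_cthickening
    intro x hx
    obtain ⟨y, hy, z, hz, rfl⟩ := support_convolution_subset _ hx
    rw [φ.support_normed_eq, hφR] at hy
    apply Metric.thickening_subset_cthickening
    rw [Metric.mem_thickening_iff]
    refine ⟨z, subset_tsupport _ hz, ?_⟩
    simp at hy ⊢
    exact hy.trans_le (min_le_left _ _)
  refine ⟨ψ, ?_, ?_, hsupp.trans hκs, fun x => ?_, fun x => ?_⟩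
  · exact hφc.contDiff_convolution_left _ φ.contDiff_normed hli
  · exact HasCompactSupport.of_support_subset_isCompact (hc.isCompact.cthickening)
      ((subset_tsupport _).trans hsupp)
  · have := φ.dist_normed_convolution_le (μ := μ) (x₀ := x) (ε := δ) hw.continuous.aestronglyMeasurable
      (fun y hy => (h1 (lt_of_lt_of_le hy (by
        rw [hφR]; exact (min_le_right _ _).trans (min_le_left _ _)))).le)
    simpa [Real.dist_eq] using this
  · have hf := (hc.hasFDerivAt_convolution_right (μ := μ) (ContinuousLinearMap.lsmul ℝ ℝ)
      (f := φ.normed μ) (φ.continuous_normed.locallyIntegrable) hw x).fderiv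
    have he : convolution (φ.normed μ) (fderiv ℝ w)
        (ContinuousLinearMap.precompR E (ContinuousLinearMap.lsmul ℝ ℝ)) μ x =
        convolution (φ.normed μ) (fderiv ℝ w) (ContinuousLinearMap.lsmul ℝ ℝ) μ x := by
      unfold convolution
      congr 1
    have := φ.dist_normed_convolution_le (μ := μ) (x₀ := x) (ε := δ) (g := fderiv ℝ w)
      hcd.aestronglyMeasurable
      (fun y hy => (h2 (lt_of_lt_of_le hy (by
        rw [hφR]; exact (min_le_right _ _).trans (min_le_right _ _)))).le)
    rw [← he, ← hf, dist_eq_norm] at this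
    exact this

variable {Ω : Set E} {D : E → ℝ} {η m : ℝ → E → ℝ} {ι : Type*} [Fintype ι] {e : ι → E}

lemma lam_C1 (hΩ : IsOpen Ω) (hfin : μ Ω < ⊤) {l : ℝ}
    (hl : ∀ ψ : E → ℝ, ContDiff ℝ (⊤ : ℕ∞) ψ → HasCompactSupport ψ → tsupport ψ ⊆ Ω →
      l * ∫ x in Ω, ψ x ^ 2 ∂μ ≤ ∫ x in Ω, ∑ i, fderiv ℝ ψ x (e i) ^ 2 ∂μ)
    {w : E → ℝ} (hw : ContDiff ℝ 1 w) (hc : HasCompactSupport w) (hs : tsupport w ⊆ Ω) :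
    l * ∫ x in Ω, w x ^ 2 ∂μ ≤ ∫ x in Ω, ∑ i, fderiv ℝ w x (e i) ^ 2 ∂μ := by
  have : Fact (μ Ω < ⊤) := ⟨hfin⟩
  have hd : ∀ n : ℕ, (0:ℝ) < 1 / ((n:ℝ) + 1) := fun n => by positivity
  choose ψ p1 p2 p3 p4 p5 using fun n : ℕ => mollify μ hΩ hw hc hs (hd n)
  have ht := tendsto_one_div_add_atTop_nhds_zero_nat (𝕜 := ℝ)
  have hle : ∀ n : ℕ, 1 / ((n:ℝ) + 1) ≤ 1 := fun n => by
    rw [div_le_one (by positivity)]; linarith [n.cast_nonneg (α := ℝ)]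
  have t1 : ∀ x, Tendsto (fun n => ψ n x) atTop (𝓝 (w x)) := fun x => by
    rw [tendsto_iff_norm_sub_tendsto_zero]
    exact squeeze_zero (fun _ => norm_nonneg _) (fun n => p4 n x) ht
  have t2 : ∀ x, Tendsto (fun n => fderiv ℝ (ψ n) x) atTop (𝓝 (fderiv ℝ w x)) := fun x => by
    rw [tendsto_iff_norm_sub_tendsto_zero]
    exact squeeze_zero (fun _ => norm_nonneg _) (fun n => p5 n x) ht
  obtain ⟨A, hA⟩ := hw.continuous.bounded_above_of_compact_support hc
  obtain ⟨B, hB⟩ := (hw.continuous_fderiv one_ne_zero).bounded_above_of_compact_support (hc.fderiv ℝ)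
  have c1 : ∀ n, ContDiff ℝ 1 (ψ n) := fun n => (p1 n).of_le (by exact_mod_cast le_top)
  have l1 : Tendsto (fun n => ∫ x in Ω, ψ n x ^ 2 ∂μ) atTop (𝓝 (∫ x in Ω, w x ^ 2 ∂μ)) := by
    apply tendsto_integral_of_dominated_convergence (fun _ => (A + 1) ^ 2)
    · exact fun n => ((c1 n).continuous.pow 2).aestronglyMeasurable
    · exact integrable_const _
    · intro n
      refine ae_of_all _ fun x => ?_
      rw [norm_pow]
      gcongr
      have h1 := p4 n x
      have h2 := hA x
      have h3 := hle n
      rw [Real.norm_eq_abs] at *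
      rw [abs_le] at *
      constructor <;> linarith [h1.1, h1.2]
    · exact ae_of_all _ fun x => (t1 x).pow 2
  have l2 : Tendsto (fun n => ∫ x in Ω, ∑ i, fderiv ℝ (ψ n) x (e i) ^ 2 ∂μ) atTop
      (𝓝 (∫ x in Ω, ∑ i, fderiv ℝ w x (e i) ^ 2 ∂μ)) := by
    apply tendsto_integral_of_dominated_convergence (fun _ => ∑ i, ((B + 1) * ‖e i‖) ^ 2)
    · exact fun n => (continuous_finsetSum _ fun i _ =>
        ((((c1 n).continuous_fderiv one_ne_zero).clm_apply continuous_const).pow 2)).aestronglyMeasurable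
    · exact integrable_const _
    · intro n
      refine ae_of_all _ fun x => ?_
      refine (norm_sum_le _ _).trans (Finset.sum_le_sum fun i _ => ?_)
      rw [norm_pow]
      gcongr
      refine (ContinuousLinearMap.le_opNorm _ _).trans ?_
      gcongr
      have h1 := p5 n x
      have := norm_sub_norm_le (fderiv ℝ (ψ n) x) (fderiv ℝ w x)
      linarith [hB x, hle n]
    · refine ae_of_all _ fun x => tendsto_finsetSum _ fun i _ => ?_
      exact (((ContinuousLinearMap.apply ℝ ℝ (e i)).continuous.tendsto _).comp (t2 x)).pow 2
  exact le_of_tendsto_of_tendsto' (l1.const_mul l) l2 fun n => hl _ (p1 n) (p2 n) (p3 n)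

lemma exit_bound (hΩ : IsOpen Ω) {u : E → ℝ} (hu : ∀ x ∈ Ω, DifferentiableAt ℝ u x)
    (huc : ContinuousOn u (closure Ω)) (hb : ∀ x ∈ frontier Ω, u x = 0) {x n : E} {s M : ℝ}
    (hs : 0 < s) (hin : ∀ σ ∈ Ico 0 s, x + σ • n ∈ Ω) (hout : x + s • n ∉ Ω)
    (hM : ∀ y ∈ Ω, |fderiv ℝ u y n| ≤ M) : |u x| ≤ M * s := by
  have hcont : Continuous (fun σ : ℝ => x + σ • n) := by fun_prop
  have hcl : ∀ σ ∈ Icc 0 s, x + σ • n ∈ closure Ω := by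
    intro σ hσ
    have : σ ∈ closure (Ico 0 s) := by rwa [closure_Ico hs.ne]
    exact map_mem_closure (f := fun σ : ℝ => x + σ • n) hcont this hin
  have h0 : u (x + s • n) = 0 := by
    apply hb
    rw [frontier, hΩ.interior_eq]
    exact ⟨hcl s ⟨hs.le, le_rfl⟩, hout⟩
  have hder : ∀ σ ∈ Ico 0 s, HasDerivAt (fun σ : ℝ => u (x + σ • n)) (fderiv ℝ u (x + σ • n) n) σ := by
    intro σ hσ
    have h1 : HasDerivAt (fun σ : ℝ => x + σ • n) n σ := by
      simpa using ((hasDerivAt_id σ).smul_const n).const_add x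
    exact (hu _ (hin σ hσ)).hasFDerivAt.comp_hasDerivAt σ h1
  have := norm_image_sub_le_of_norm_deriv_right_le_segment (f := fun σ : ℝ => u (x + σ • n))
    (huc.comp hcont.continuousOn hcl)
    (fun σ hσ => (hder σ hσ).hasDerivWithinAt)
    (fun σ hσ => hM _ (hin σ hσ)) s ⟨hs.le, le_rfl⟩
  simpa [h0] using this

lemma zero_of_int (hΩ : IsOpen Ω) {q : E → ℝ} (hc : ContinuousOn q Ω) (hi : IntegrableOn q Ω μ)
    (h0 : ∀ x ∈ Ω, 0 ≤ q x) (hq : ∫ x in Ω, q x ∂μ ≤ 0) : ∀ x ∈ Ω, q x = 0 := by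
  have hae : 0 ≤ᵐ[μ.restrict Ω] q := (ae_restrict_iff' hΩ.measurableSet).2 (ae_of_all _ h0)
  have h1 : ∫ x in Ω, q x ∂μ = 0 := le_antisymm hq (integral_nonneg_of_ae hae)
  have h2 := (integral_eq_zero_iff_of_nonneg_ae hae hi).1 h1
  exact Measure.eqOn_open_of_ae_eq h2 hΩ hc continuousOn_const

/-- vanishing at the boundary -/
def Sm (Ω : Set E) (D q : E → ℝ) : Prop := ∀ δ > 0, ∃ ε₀ > 0, ∀ x ∈ Ω, D x < ε₀ → |q x| ≤ δ

lemma Sm.add {p q : E → ℝ} (hp : Sm Ω D p) (hq : Sm Ω D q) : Sm Ω D (fun x => p x + q x) := by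
  intro δ hδ
  obtain ⟨a, ha, h1⟩ := hp _ (half_pos hδ)
  obtain ⟨b, hb, h2⟩ := hq _ (half_pos hδ)
  refine ⟨min a b, by positivity, fun x hx hd => (abs_add_le _ _).trans ?_⟩
  linarith [h1 x hx (hd.trans_le (min_le_left _ _)), h2 x hx (hd.trans_le (min_le_right _ _))]

lemma Sm.mul {p q : E → ℝ} (hp : Sm Ω D p) {K ε₁ : ℝ} (hε : 0 < ε₁)
    (hq : ∀ x ∈ Ω, D x < ε₁ → |q x| ≤ K) : Sm Ω D (fun x => p x * q x) := by
  intro δ hδ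
  obtain ⟨a, ha, h1⟩ := hp (δ / (|K| + 1)) (by positivity)
  refine ⟨min a ε₁, by positivity, fun x hx hd => ?_⟩
  rw [abs_mul]
  have h3 := h1 x hx (hd.trans_le (min_le_left _ _))
  have h4 := hq x hx (hd.trans_le (min_le_right _ _))
  calc |p x| * |q x| ≤ (δ / (|K| + 1)) * (|K| + 1) := by
        gcongr; exact h4.trans ((le_abs_self K).trans (by linarith))
    _ = δ := by field_simp

lemma Sm.mulBC {p q : E → ℝ} (hp : Sm Ω D p) (hq : BC Ω q) : Sm Ω D (fun x => p x * q x) := by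
  obtain ⟨_, K, h⟩ := hq
  exact hp.mul one_pos (fun x hx _ => h x hx)

lemma Sm.congr {p q : E → ℝ} (hp : Sm Ω D p) {ε₁ : ℝ} (hε : 0 < ε₁)
    (hq : ∀ x ∈ Ω, D x < ε₁ → q x = p x) : Sm Ω D q := by
  intro δ hδ
  obtain ⟨a, ha, h1⟩ := hp _ hδ
  refine ⟨min a ε₁, by positivity, fun x hx hd => ?_⟩
  rw [hq x hx (hd.trans_le (min_le_right _ _))]
  exact h1 x hx (hd.trans_le (min_le_left _ _))

lemma Sm.of_le {p : E → ℝ} (hpos : ∀ x ∈ Ω, 0 < D x) {C : ℝ} (h : ∀ x ∈ Ω, |p x| ≤ C * D x) : Sm Ω D p := by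
  intro δ hδ
  refine ⟨δ / (|C| + 1), by positivity, fun x hx hd => (h x hx).trans ?_⟩
  rw [lt_div_iff₀ (by positivity)] at hd
  nlinarith [le_abs_self C, hpos x hx]

lemma poh_bound {u F : E → ℝ} {V : ι → E → ℝ}
    (hD : ∀ i, BC Ω (fun x => fderiv ℝ D x (e i))) (hu : ∀ i, BC Ω (fun x => fderiv ℝ u x (e i)))
    (hV : ∀ i, BC Ω (V i)) {s₀ ε₁ : ℝ} (hs₀ : 0 < s₀) (hε₁ : 0 < ε₁)
    (hS : ∀ x ∈ Ω, D x < ε₁ → s₀ ≤ ∑ i, fderiv ℝ D x (e i) ^ 2)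
    (htan : ∀ c : ι → E → ℝ, (∀ i, BC Ω (c i)) → (∀ x ∈ Ω, ∑ i, c i x * fderiv ℝ D x (e i) = 0) →
      Sm Ω D (fun x => ∑ i, c i x * fderiv ℝ u x (e i)))
    (hF : Sm Ω D F) :
    Sm Ω D (fun x => ∑ i, fderiv ℝ D x (e i) * ((∑ j, V j x * fderiv ℝ u x (e j)) * fderiv ℝ u x (e i)
      - 1 / 2 * (∑ j, fderiv ℝ u x (e j) ^ 2) * V i x + F x * V i x)
      - 1 / 2 * (∑ j, fderiv ℝ u x (e j) ^ 2) * ∑ i, V i x * fderiv ℝ D x (e i)) := by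
  set S : E → ℝ := fun x => ∑ i, fderiv ℝ D x (e i) ^ 2 with hSdef
  set VD : E → ℝ := fun x => ∑ i, V i x * fderiv ℝ D x (e i) with hVD
  set UD : E → ℝ := fun x => ∑ i, fderiv ℝ u x (e i) * fderiv ℝ D x (e i) with hUD
  have bS : BC Ω S := BC.sum _ fun i => (hD i).pow 2
  have bVD : BC Ω VD := BC.sum _ fun i => (hV i).mul (hD i)
  have bUD : BC Ω UD := BC.sum _ fun i => (hu i).mul (hD i)
  have alg : ∀ (a : E → ι → ℝ) (x : E), ∑ i, (a x i * S x - (∑ j, a x j * fderiv ℝ D x (e j)) * fderiv ℝ D x (e i)) * fderiv ℝ D x (e i) = 0 := by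
    intro a x
    simp only [sub_mul, Finset.sum_sub_distrib]
    have h1 : ∑ i, a x i * S x * fderiv ℝ D x (e i) = S x * ∑ j, a x j * fderiv ℝ D x (e j) := by
      rw [Finset.mul_sum]; exact Finset.sum_congr rfl fun i _ => by ring
    have h2 : ∑ i, (∑ j, a x j * fderiv ℝ D x (e j)) * fderiv ℝ D x (e i) * fderiv ℝ D x (e i) = (∑ j, a x j * fderiv ℝ D x (e j)) * S x := by
      simp only [hSdef]
      rw [Finset.mul_sum]; exact Finset.sum_congr rfl fun i _ => by ring
    rw [h1, h2]; ring
  have t1 := htan (fun i x => V i x * S x - VD x * fderiv ℝ D x (e i))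
    (fun i => ((hV i).mul bS).sub (bVD.mul (hD i))) (fun x _ => alg (fun x i => V i x) x)
  have t2 := htan (fun i x => fderiv ℝ u x (e i) * S x - UD x * fderiv ℝ D x (e i))
    (fun i => ((hu i).mul bS).sub (bUD.mul (hD i))) (fun x _ => alg (fun x i => fderiv ℝ u x (e i)) x)
  have hinv : ∀ x ∈ Ω, D x < ε₁ → |(S x)⁻¹| ≤ s₀⁻¹ := by
    intro x hx hd
    have h1 := hS x hx hd
    have h1' : s₀ ≤ S x := h1
    rw [abs_of_pos (inv_pos.2 (hs₀.trans_le h1'))]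
    exact inv_anti₀ hs₀ h1'
  have t3 := ((t1.mulBC bUD).add ((t2.mulBC bVD).mulBC (BC.const (-1)))).mul hε₁ hinv
  refine (t3.add (hF.mulBC bVD)).congr hε₁ fun x hx hd => ?_
  have hSpos : 0 < S x := hs₀.trans_le (hS x hx hd)
  have r1 : ∑ i, (V i x * S x - VD x * fderiv ℝ D x (e i)) * fderiv ℝ u x (e i) =
      S x * (∑ j, V j x * fderiv ℝ u x (e j)) - VD x * UD x := by
    simp only [sub_mul, Finset.sum_sub_distrib]
    congr 1
    · rw [Finset.mul_sum]; exact Finset.sum_congr rfl fun i _ => by ring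
    · simp only [hUD]; rw [Finset.mul_sum]; exact Finset.sum_congr rfl fun i _ => by ring
  have r2 : ∑ i, (fderiv ℝ u x (e i) * S x - UD x * fderiv ℝ D x (e i)) * fderiv ℝ u x (e i) =
      S x * (∑ j, fderiv ℝ u x (e j) ^ 2) - UD x * UD x := by
    simp only [sub_mul, Finset.sum_sub_distrib]
    congr 1
    · rw [Finset.mul_sum]; exact Finset.sum_congr rfl fun i _ => by ring
    · simp only [hUD]; rw [Finset.mul_sum]; exact Finset.sum_congr rfl fun i _ => by ring
  have r3 : ∑ i, fderiv ℝ D x (e i) * ((∑ j, V j x * fderiv ℝ u x (e j)) * fderiv ℝ u x (e i)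
      - 1 / 2 * (∑ j, fderiv ℝ u x (e j) ^ 2) * V i x + F x * V i x) =
      (∑ j, V j x * fderiv ℝ u x (e j)) * UD x - 1 / 2 * (∑ j, fderiv ℝ u x (e j) ^ 2) * VD x
        + F x * VD x := by
    simp only [hUD, hVD]
    generalize (∑ j, V j x * fderiv ℝ u x (e j)) = P
    generalize (∑ j, fderiv ℝ u x (e j) ^ 2) = Q
    simp only [Finset.mul_sum, ← Finset.sum_sub_distrib, ← Finset.sum_add_distrib]
    exact Finset.sum_congr rfl fun i _ => by ring
  rw [r1, r2, r3]
  field_simp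
  ring

/-- `λ₁ ∫ u² ≤ ∫ |∇u|²`. -/
lemma lam_u (h : Cut μ Ω D η m) {l : ℝ}
    (hl : ∀ ψ : E → ℝ, ContDiff ℝ (⊤ : ℕ∞) ψ → HasCompactSupport ψ → tsupport ψ ⊆ Ω →
      l * ∫ x in Ω, ψ x ^ 2 ∂μ ≤ ∫ x in Ω, ∑ i, fderiv ℝ ψ x (e i) ^ 2 ∂μ)
    {u : E → ℝ} (hu : ContDiffOn ℝ 1 u Ω) (hub : BC Ω u)
    (hD : ∀ i, BC Ω (fun x => fderiv ℝ D x (e i))) (hui : ∀ i, BC Ω (fun x => fderiv ℝ u x (e i)))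
    {C : ℝ} (hC : ∀ x ∈ Ω, |u x| ≤ C * D x) (hDdiff : ∀ x ∈ Ω, DifferentiableAt ℝ D x) :
    l * ∫ x in Ω, u x ^ 2 ∂μ ≤ ∫ x in Ω, ∑ i, fderiv ℝ u x (e i) ^ 2 ∂μ := by
  have : Fact (μ Ω < ⊤) := ⟨h.fin⟩
  have hsub : ∀ ε > 0, tsupport (fun x => η ε x * u x) ⊆ Ω := fun ε hε =>
    (closure_mono (Function.support_mul_subset_left (η ε) u)).trans (h.supp ε hε)
  have c1 : ∀ ε > 0, ContDiff ℝ 1 (fun x => η ε x * u x) := by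
    intro ε hε
    rw [contDiff_iff_contDiffAt]
    intro x
    by_cases hx : x ∈ tsupport (fun x => η ε x * u x)
    · exact (h.smooth ε hε).contDiffAt.mul (hu.contDiffAt (h.isOpen.mem_nhds (hsub ε hε hx)))
    · exact (contDiffAt_const (c := (0:ℝ))).congr_of_eventuallyEq (notMem_tsupport_iff_eventuallyEq.1 hx)
  have c2 : ∀ ε > 0, ∀ x ∈ Ω, ∀ i, fderiv ℝ (fun x => η ε x * u x) x (e i) =
      η ε x * fderiv ℝ u x (e i) + u x * (m ε x * fderiv ℝ D x (e i)) := by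
    intro ε hε x hx i
    have := fderiv_fun_mul ((h.smooth ε hε).differentiable one_ne_zero x)
      ((hu.contDiffAt (h.isOpen.mem_nhds hx)).differentiableAt one_ne_zero)
    rw [this, h.deriv ε hε x hx]
    simp
  have key : ∀ᶠ ε in 𝓝[>] (0:ℝ), l * ∫ x in Ω, (η ε x * u x) ^ 2 ∂μ ≤
      ∫ x in Ω, ∑ i, (η ε x * fderiv ℝ u x (e i) + u x * (m ε x * fderiv ℝ D x (e i))) ^ 2 ∂μ := by
    filter_upwards [self_mem_nhdsWithin] with ε hε
    have := lam_C1 (e := e) h.isOpen h.fin hl (c1 ε hε) (h.cpt ε hε).mul_right (hsub ε hε)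
    rwa [setIntegral_congr_fun (f := fun x => ∑ i, fderiv ℝ (fun x => η ε x * u x) x (e i) ^ 2)
      h.isOpen.measurableSet (fun x hx => by
        simp only [c2 ε hε x hx]; rfl)] at this
  have hm0 : ∀ x ∈ Ω, ∀ᶠ ε in 𝓝[>] (0:ℝ), m ε x = 0 := by
    intro x hx
    filter_upwards [self_mem_nhdsWithin, mem_nhdsWithin_of_mem_nhds
      (Iio_mem_nhds (half_pos (h.pos x hx)))] with ε hε hlt
    exact h.m_supp ε hε x (by have : ε < D x / 2 := hlt; linarith)
  obtain ⟨huc, A, hA⟩ := hub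
  have l1 : Tendsto (fun ε => ∫ x in Ω, (η ε x * u x) ^ 2 ∂μ) (𝓝[>] (0:ℝ)) (𝓝 (∫ x in Ω, u x ^ 2 ∂μ)) := by
    apply tendsto_integral_filter_of_dominated_convergence (fun _ => A ^ 2)
    · filter_upwards [self_mem_nhdsWithin] with ε hε
      exact ((c1 ε hε).continuous.pow 2).aestronglyMeasurable
    · filter_upwards [self_mem_nhdsWithin] with ε hε
      refine (ae_restrict_iff' h.isOpen.measurableSet).2 (ae_of_all _ fun x hx => ?_)
      rw [norm_pow, norm_mul, Real.norm_of_nonneg (h.nonneg ε x)]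
      refine pow_le_pow_left₀ (mul_nonneg (h.nonneg ε x) (norm_nonneg _)) ?_ 2
      exact (mul_le_of_le_one_left (norm_nonneg (u x)) (h.le_one ε x)).trans (hA x hx)
    · exact integrable_const _
    · refine (ae_restrict_iff' h.isOpen.measurableSet).2 (ae_of_all _ fun x hx => ?_)
      simpa using ((h.tends x hx).mul_const (u x)).pow 2
  obtain ⟨K, hK⟩ := h.mD
  choose hDc B hB using hD
  choose huic U hU using hui
  have l2 : Tendsto (fun ε => ∫ x in Ω, ∑ i, (η ε x * fderiv ℝ u x (e i) + u x * (m ε x * fderiv ℝ D x (e i))) ^ 2 ∂μ)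
      (𝓝[>] (0:ℝ)) (𝓝 (∫ x in Ω, ∑ i, fderiv ℝ u x (e i) ^ 2 ∂μ)) := by
    apply tendsto_integral_filter_of_dominated_convergence (fun _ => ∑ i, (U i + |C| * |K| * B i) ^ 2)
    · filter_upwards [self_mem_nhdsWithin] with ε hε
      refine ContinuousOn.aestronglyMeasurable ?_ h.isOpen.measurableSet
      refine continuousOn_finsetSum _ fun i _ => ContinuousOn.pow ?_ 2
      exact ((h.smooth ε hε).continuous.continuousOn.mul (huic i)).add
        (huc.mul ((h.m_cont ε hε).mul (hDc i)))
    · filter_upwards [self_mem_nhdsWithin] with ε hε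
      refine (ae_restrict_iff' h.isOpen.measurableSet).2 (ae_of_all _ fun x hx => ?_)
      refine (norm_sum_le _ _).trans (Finset.sum_le_sum fun i _ => ?_)
      rw [norm_pow]
      gcongr
      refine (norm_add_le _ _).trans (add_le_add ?_ ?_)
      · rw [norm_mul, Real.norm_of_nonneg (h.nonneg ε x)]
        exact (mul_le_of_le_one_left (norm_nonneg _) (h.le_one ε x)).trans (hU i x hx)
      · rw [← mul_assoc, norm_mul, norm_mul, Real.norm_of_nonneg (h.m_nonneg ε hε x)]
        refine mul_le_mul ?_ (hB i x hx) (norm_nonneg _) (by positivity)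
        have h1 := hC x hx
        have h2 := hK ε hε x hx
        have h3 := h.m_nonneg ε hε x
        have h4 := h.pos x hx
        calc ‖u x‖ * m ε x ≤ (|C| * D x) * m ε x := by
              gcongr; exact h1.trans (by gcongr; exact le_abs_self C)
          _ = |C| * (m ε x * D x) := by ring
          _ ≤ |C| * |K| := by gcongr; exact h2.trans (le_abs_self K)
    · exact integrable_const _
    · refine (ae_restrict_iff' h.isOpen.measurableSet).2 (ae_of_all _ fun x hx => ?_)
      refine tendsto_finsetSum _ fun i _ => ?_
      have h1 : Tendsto (fun ε => (η ε x * fderiv ℝ u x (e i)) ^ 2) (𝓝[>] (0:ℝ)) (𝓝 (fderiv ℝ u x (e i) ^ 2)) := by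
        simpa using ((h.tends x hx).mul_const (fderiv ℝ u x (e i))).pow 2
      refine h1.congr' ?_
      filter_upwards [hm0 x hx] with ε hε
      rw [hε]; simp
  exact le_of_tendsto_of_tendsto (l1.const_mul l) l2 key

end gen2
end PZ
end

open MeasureTheory

noncomputable section
set_option linter.unusedSectionVars false
namespace PZ
open Filter Topology Set

section gen3
variable {E : Type*} [NormedAddCommGroup E] [NormedSpace ℝ E] [FiniteDimensional ℝ E]
  [MeasurableSpace E] [BorelSpace E] {μ : Measure E} [μ.IsAddHaarMeasure]
variable {Ω : Set E} {D : E → ℝ} {η m : ℝ → E → ℝ} {ι : Type*} [Fintype ι] {e : ι → E}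

lemma c1_partial (hΩ : IsOpen Ω) {u : E → ℝ} (hu : ContDiffOn ℝ 2 u Ω) (v : E) :
    ContDiffOn ℝ 1 (fun x => fderiv ℝ u x v) Ω :=
  (hu.fderiv_of_isOpen hΩ (by norm_num)).clm_apply contDiffOn_const

lemma energy (h : Cut μ Ω D η m) {u : E → ℝ} (hu : ContDiffOn ℝ 2 u Ω) (hub : BC Ω u)
    (hui : ∀ i, BC Ω (fun x => fderiv ℝ u x (e i))) (hD : ∀ i, BC Ω (fun x => fderiv ℝ D x (e i)))
    {C : ℝ} (hC : ∀ x ∈ Ω, |u x| ≤ C * D x)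
    (hlap : BC Ω (fun x => ∑ i, fderiv ℝ (fun y => fderiv ℝ u y (e i)) x (e i))) :
    ∫ x in Ω, (∑ i, fderiv ℝ u x (e i) ^ 2 +
      u x * ∑ i, fderiv ℝ (fun y => fderiv ℝ u y (e i)) x (e i)) ∂μ = 0 := by
  have hdiv : ∀ x ∈ Ω, ∑ i, fderiv ℝ (fun y => u y * fderiv ℝ u y (e i)) x (e i) =
      ∑ i, fderiv ℝ u x (e i) ^ 2 +
      u x * ∑ i, fderiv ℝ (fun y => fderiv ℝ u y (e i)) x (e i) := by
    intro x hx
    rw [Finset.mul_sum, ← Finset.sum_add_distrib]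
    refine Finset.sum_congr rfl fun i _ => ?_
    rw [fderiv_fun_mul ((hu.contDiffAt (h.isOpen.mem_nhds hx)).differentiableAt two_ne_zero)
      (((c1_partial h.isOpen hu (e i)).contDiffAt (h.isOpen.mem_nhds hx)).differentiableAt one_ne_zero)]
    simp; ring
  have hb : BC Ω (fun x => ∑ i, fderiv ℝ u x (e i) ^ 2 +
      u x * ∑ i, fderiv ℝ (fun y => fderiv ℝ u y (e i)) x (e i)) :=
    (BC.sum _ fun i => (hui i).pow 2).add (hub.mul hlap)
  rw [← setIntegral_congr_fun h.isOpen.measurableSet hdiv]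
  have hq : BC Ω (fun x => |∑ i, fderiv ℝ D x (e i) * (u x * fderiv ℝ u x (e i))|) :=
    (BC.sum _ fun i => (hD i).mul (hub.mul (hui i))).abs
  refine h.div_zero (fun i => (hu.of_le (by norm_num)).mul (c1_partial h.isOpen hu (e i)))
    ((hb.congr hdiv).integrableOn h.isOpen h.fin) hq (fun x hx => le_rfl) ?_
  refine h.m_tendsto hq (fun x _ => abs_nonneg _) ?_
  have := ((Sm.of_le h.pos hC).mulBC (BC.sum Finset.univ fun i => (hD i).mul (hui i)))
  intro δ hδ
  obtain ⟨a, ha, h1⟩ := this δ hδ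
  refine ⟨a, ha, fun x hx hd => ?_⟩
  convert h1 x hx hd using 2
  show _ = u x * ∑ i, fderiv ℝ D x (e i) * fderiv ℝ u x (e i)
  rw [Finset.mul_sum]
  exact Finset.sum_congr rfl fun i _ => by ring

lemma pohozaev (h : Cut μ Ω D η m) {F f : ℝ → ℝ} {u : E → ℝ} (hu : ContDiffOn ℝ 2 u Ω) (hub : BC Ω u)
    (hui : ∀ i, BC Ω (fun x => fderiv ℝ u x (e i))) (hD : ∀ i, BC Ω (fun x => fderiv ℝ D x (e i)))
    (hF : ContDiff ℝ 1 F) (hFf : ∀ s, HasDerivAt F (f s) s) (hFs : Sm Ω D (fun x => F (u x)))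
    (hpde : ∀ x ∈ Ω, ∑ i, fderiv ℝ (fun y => fderiv ℝ u y (e i)) x (e i) = - f (u x))
    {V : ι → E → ℝ} (hV : ∀ i, ContDiffOn ℝ 1 (V i) Ω) (hVb : ∀ i, BC Ω (V i))
    (hVd : ∀ i j, BC Ω (fun x => fderiv ℝ (V j) x (e i)))
    {s₀ ε₁ : ℝ} (hs₀ : 0 < s₀) (hε₁ : 0 < ε₁)
    (hS : ∀ x ∈ Ω, D x < ε₁ → s₀ ≤ ∑ i, fderiv ℝ D x (e i) ^ 2)
    (htan : ∀ c : ι → E → ℝ, (∀ i, BC Ω (c i)) → (∀ x ∈ Ω, ∑ i, c i x * fderiv ℝ D x (e i) = 0) →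
      Sm Ω D (fun x => ∑ i, c i x * fderiv ℝ u x (e i)))
    {q : E → ℝ} (hq : BC Ω q) {C : ℝ}
    (hqV : ∀ x ∈ Ω, 1 / 2 * (∑ j, fderiv ℝ u x (e j) ^ 2) * ∑ i, V i x * fderiv ℝ D x (e i) + q x ≤ C * D x)
    {δ : ℝ} (hδ : 0 < δ) :
    ∀ᶠ ε in 𝓝[>] (0:ℝ), ∫ x in Ω, m ε x * q x ∂μ ≤
      ∫ x in Ω, (∑ i, ∑ j, fderiv ℝ (V j) x (e i) * (fderiv ℝ u x (e i) * fderiv ℝ u x (e j))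
        + (F (u x) - 1 / 2 * ∑ j, fderiv ℝ u x (e j) ^ 2) * ∑ i, fderiv ℝ (V i) x (e i)) ∂μ + δ := by
  have hFc : Continuous F := hF.continuous
  have hP : ∀ i, ContDiffOn ℝ 1 (fun x => fderiv ℝ u x (e i)) Ω := fun i => c1_partial h.isOpen hu (e i)
  have hu1 : ContDiffOn ℝ 1 u Ω := hu.of_le (by norm_num)
  have hX0 : ∀ i, ContDiffOn ℝ 1 (fun x => (∑ j, V j x * fderiv ℝ u x (e j)) * fderiv ℝ u x (e i)
      - 1 / 2 * (∑ j, fderiv ℝ u x (e j) ^ 2) * V i x) Ω := fun i =>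
    ((ContDiffOn.sum fun j _ => (hV j).mul (hP j)).mul (hP i)).sub
      ((contDiffOn_const.mul (ContDiffOn.sum fun j _ => (hP j).pow 2)).mul (hV i))
  have hX1 : ∀ i, ContDiffOn ℝ 1 (fun x => F (u x) * V i x) Ω := fun i =>
    (hF.comp_contDiffOn hu1).mul (hV i)
  have hdiv : ∀ x ∈ Ω, ∑ i, fderiv ℝ (fun x => (∑ j, V j x * fderiv ℝ u x (e j)) * fderiv ℝ u x (e i)
      - 1 / 2 * (∑ j, fderiv ℝ u x (e j) ^ 2) * V i x + F (u x) * V i x) x (e i) =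
      ∑ i, ∑ j, fderiv ℝ (V j) x (e i) * (fderiv ℝ u x (e i) * fderiv ℝ u x (e j))
        + (F (u x) - 1 / 2 * ∑ j, fderiv ℝ u x (e j) ^ 2) * ∑ i, fderiv ℝ (V i) x (e i) := by
    intro x hx
    have hn := h.isOpen.mem_nhds hx
    have d0 := fun i => ((hX0 i).contDiffAt hn).differentiableAt one_ne_zero
    have d1 := fun i => ((hX1 i).contDiffAt hn).differentiableAt one_ne_zero
    have e1 : ∀ i, fderiv ℝ (fun x => F (u x) * V i x) x (e i) =
        F (u x) * fderiv ℝ (V i) x (e i) + f (u x) * (V i x * fderiv ℝ u x (e i)) := by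
      intro i
      have g1 := (hFf (u x)).comp_hasFDerivAt x ((hu1.contDiffAt hn).differentiableAt one_ne_zero).hasFDerivAt
      have g2 := (g1.mul (((hV i).contDiffAt hn).differentiableAt one_ne_zero).hasFDerivAt).fderiv
      refine (congrArg (fun L => L (e i)) g2).trans ?_
      simp
      ring
    have e2 : ∀ i, fderiv ℝ (fun x => (∑ j, V j x * fderiv ℝ u x (e j)) * fderiv ℝ u x (e i)
      - 1 / 2 * (∑ j, fderiv ℝ u x (e j) ^ 2) * V i x + F (u x) * V i x) x (e i) = 
      fderiv ℝ (fun x => (∑ j, V j x * fderiv ℝ u x (e j)) * fderiv ℝ u x (e i)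
      - 1 / 2 * (∑ j, fderiv ℝ u x (e j) ^ 2) * V i x) x (e i) + 
        (F (u x) * fderiv ℝ (V i) x (e i) + f (u x) * (V i x * fderiv ℝ u x (e i))) := by
      intro i
      rw [fderiv_fun_add (d0 i) (d1 i), ← e1 i]; rfl
    simp only [e2]
    rw [Finset.sum_add_distrib, poh_div (hu.contDiffAt hn)
      (fun i => ((hV i).contDiffAt hn).differentiableAt one_ne_zero), hpde x hx,
      Finset.sum_add_distrib, ← Finset.mul_sum, ← Finset.mul_sum]
    ring
  have bQ : BC Ω (fun x => ∑ j, fderiv ℝ u x (e j) ^ 2) := BC.sum _ fun j => (hui j).pow 2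
  have hb : BC Ω (fun x => ∑ i, ∑ j, fderiv ℝ (V j) x (e i) * (fderiv ℝ u x (e i) * fderiv ℝ u x (e j))
        + (F (u x) - 1 / 2 * ∑ j, fderiv ℝ u x (e j) ^ 2) * ∑ i, fderiv ℝ (V i) x (e i)) :=
    (BC.sum _ fun i => BC.sum _ fun j => (hVd i j).mul ((hui i).mul (hui j))).add
      (((hub.comp hFc).sub ((BC.const _).mul bQ)).mul (BC.sum _ fun i => hVd i i))
  rw [← setIntegral_congr_fun h.isOpen.measurableSet hdiv]
  refine h.div_lim (fun i => (hX0 i).add (hX1 i)) ((hb.congr hdiv).integrableOn h.isOpen h.fin) hq ?_ ?_ hδ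
  · exact BC.sum _ fun i => (hD i).mul ((((BC.sum _ fun j => (hVb j).mul (hui j)).mul (hui i)).sub
      (((BC.const _).mul bQ).mul (hVb i))).add ((hub.comp hFc).mul (hVb i)))
  · intro δ hδ
    obtain ⟨a, ha, h1⟩ := poh_bound hD hui hVb hs₀ hε₁ hS htan hFs _ (half_pos hδ)
    refine ⟨min a (δ / 2 / (|C| + 1)), by positivity, fun x hx hd => ?_⟩
    have h2 := (abs_le.1 (h1 x hx (hd.trans_le (min_le_left _ _)))).2
    have h3 := hqV x hx
    have h4 := hd.trans_le (min_le_right _ _)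
    rw [lt_div_iff₀ (by positivity)] at h4
    have h5 : C * D x ≤ δ / 2 := by nlinarith [le_abs_self C, h.pos x hx]
    linarith

lemma carleman [DecidableEq ι] (h : Cut μ Ω D η m) {u : E → ℝ} (hu : ContDiffOn ℝ 2 u Ω) (hub : BC Ω u)
    (hui : ∀ i, BC Ω (fun x => fderiv ℝ u x (e i))) (hD : ∀ i, BC Ω (fun x => fderiv ℝ D x (e i)))
    {C : ℝ} (hC : ∀ x ∈ Ω, |u x| ≤ C * D x)
    (hlap : BC Ω (fun x => ∑ i, fderiv ℝ (fun y => fderiv ℝ u y (e i)) x (e i)))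
    {M : ℝ} (hM0 : 0 ≤ M)
    (hM : ∀ x ∈ Ω, |∑ i, fderiv ℝ (fun y => fderiv ℝ u y (e i)) x (e i)| ≤ M * |u x|)
    (hm : Tendsto (fun ε => ∫ x in Ω, m ε x * ∑ i, fderiv ℝ u x (e i) ^ 2 ∂μ) (𝓝[>] 0) (𝓝 0))
    (ℓ : E →L[ℝ] ℝ) (i₀ : ι) (hℓ : ∀ i, ℓ (e i) = if i = i₀ then 1 else 0) {L : ℝ} (hL : 0 < L)
    (hℓL : ∀ x ∈ Ω, |ℓ x| ≤ L) : ∀ x ∈ Ω, u x = 0 := by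
  set τ : ℝ := M * L + 1 with hτ
  have bℓ : BC Ω (fun x => ℓ x) := ⟨ℓ.continuous.continuousOn, L, hℓL⟩
  set a : E → ℝ := fun x => Real.exp (τ * ℓ x) with ha
  have ba : BC Ω a := bℓ.comp (φ := fun s => Real.exp (τ * s)) (by fun_prop)
  have ca : ContDiff ℝ 2 a := by
    apply Real.contDiff_exp.comp; exact contDiff_const.mul ℓ.contDiff
  have fa : ∀ x, HasFDerivAt a ((a x * τ) • ℓ) x := by
    intro x
    have := (((ℓ.hasFDerivAt (x := x)).const_mul τ).exp)
    convert this using 1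
    ext v; simp [ha]; ring
  set w : E → ℝ := fun x => a x * u x with hw
  have cw : ContDiffOn ℝ 2 w Ω := ca.contDiffOn.mul hu
  have hP : ∀ i, ContDiffOn ℝ 1 (fun x => fderiv ℝ u x (e i)) Ω := fun i => c1_partial h.isOpen hu (e i)
  have du : ∀ x ∈ Ω, DifferentiableAt ℝ u x := fun x hx =>
    (hu.contDiffAt (h.isOpen.mem_nhds hx)).differentiableAt two_ne_zero
  have dP : ∀ x ∈ Ω, ∀ i, DifferentiableAt ℝ (fun x => fderiv ℝ u x (e i)) x := fun x hx i =>
    ((hP i).contDiffAt (h.isOpen.mem_nhds hx)).differentiableAt one_ne_zero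
  have w1 : ∀ x ∈ Ω, ∀ i, fderiv ℝ w x (e i) = a x * (fderiv ℝ u x (e i) + τ * ℓ (e i) * u x) := by
    intro x hx i
    rw [hw, ((fa x).fun_mul (du x hx).hasFDerivAt).fderiv]
    simp; ring
  have w2 : ∀ x ∈ Ω, ∀ i, fderiv ℝ (fun y => fderiv ℝ w y (e i)) x (e i) =
      a x * (fderiv ℝ (fun y => fderiv ℝ u y (e i)) x (e i) + 2 * τ * ℓ (e i) * fderiv ℝ u x (e i)
        + τ ^ 2 * ℓ (e i) ^ 2 * u x) := by
    intro x hx i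
    have : (fun y => fderiv ℝ w y (e i)) =ᶠ[𝓝 x]
        fun y => a y * (fderiv ℝ u y (e i) + τ * ℓ (e i) * u y) := by
      filter_upwards [h.isOpen.mem_nhds hx] with y hy using w1 y hy i
    rw [this.fderiv_eq, ((fa x).fun_mul ((dP x hx i).hasFDerivAt.fun_add
      ((du x hx).hasFDerivAt.const_mul (τ * ℓ (e i))))).fderiv]
    simp; ring
  -- Laplacian of w
  have lapw : ∀ x ∈ Ω, ∑ i, fderiv ℝ (fun y => fderiv ℝ w y (e i)) x (e i) =
      a x * (∑ i, fderiv ℝ (fun y => fderiv ℝ u y (e i)) x (e i)) + 2 * τ * fderiv ℝ w x (e i₀)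
        - τ ^ 2 * w x := by
    intro x hx
    rw [Finset.sum_congr rfl fun i _ => w2 x hx i, ← Finset.mul_sum, Finset.sum_add_distrib,
      Finset.sum_add_distrib, w1 x hx]
    simp [hℓ, hw]
    ring
  have bw : BC Ω w := ba.mul hub
  have bwi : ∀ i, BC Ω (fun x => fderiv ℝ w x (e i)) := fun i =>
    (ba.mul ((hui i).add ((BC.const (τ * ℓ (e i))).mul hub))).congr (fun x hx => w1 x hx i)
  have int : ∀ {q : E → ℝ}, BC Ω q → IntegrableOn q Ω μ := fun hq => hq.integrableOn h.isOpen h.fin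
  -- boundary smallness
  have smu : Sm Ω D u := Sm.of_le h.pos hC
  have mu2 : Tendsto (fun ε => ∫ x in Ω, m ε x * u x ^ 2 ∂μ) (𝓝[>] 0) (𝓝 0) := by
    refine h.m_tendsto (hub.pow 2) (fun x _ => sq_nonneg _) ?_
    intro δ hδ
    obtain ⟨b, hb, h1⟩ := (smu.mulBC hub) δ hδ
    exact ⟨b, hb, fun x hx hd => by rw [pow_two]; exact (le_abs_self _).trans (h1 x hx hd)⟩
  have bgr : BC Ω (fun x => ∑ i, fderiv ℝ u x (e i) ^ 2) := BC.sum _ fun i => (hui i).pow 2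
  have mq : ∀ K : ℝ, Tendsto (fun ε => ∫ x in Ω, m ε x * (K * (∑ i, fderiv ℝ u x (e i) ^ 2 + u x ^ 2)) ∂μ) (𝓝[>] 0) (𝓝 0) := by
    intro K
    have := (hm.add mu2).const_mul K
    simp only [add_zero, mul_zero] at this
    refine this.congr' ?_
    filter_upwards [self_mem_nhdsWithin] with ε hε
    rw [← integral_add (h.m_mul_int bgr hε) (h.m_mul_int (hub.pow 2) hε), ← integral_const_mul]
    congr 1; ext x; ring
  obtain ⟨_, A, hA⟩ := ba
  choose hDc B hB using hD
  have hD : ∀ i, BC Ω (fun x => fderiv ℝ D x (e i)) := fun i => ⟨hDc i, B i, hB i⟩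
  set V : ι → E → ℝ := fun i _ => ℓ (e i) with hV
  have hVs : ∀ (g : ι → ℝ), ∑ j, ℓ (e j) * g j = g i₀ := by intro g; simp [hℓ]
  -- identity 1
  have cw1 : ∀ i, ContDiffOn ℝ 1 (fun x => fderiv ℝ w x (e i)) Ω := fun i => c1_partial h.isOpen cw (e i)
  have cw0 : ContDiffOn ℝ 1 w Ω := cw.of_le (by norm_num)
  have I1 : ∫ x in Ω, (fderiv ℝ w x (e i₀) * (a x * (∑ i, fderiv ℝ (fun y => fderiv ℝ u y (e i)) x (e i)))
      + 2 * τ * fderiv ℝ w x (e i₀) ^ 2) ∂μ = 0 := by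
    have hX0 : ∀ i, ContDiffOn ℝ 1 (fun x => (∑ j, V j x * fderiv ℝ w x (e j)) * fderiv ℝ w x (e i)
      - 1 / 2 * (∑ j, fderiv ℝ w x (e j) ^ 2) * V i x) Ω := fun i =>
      ((ContDiffOn.sum fun j _ => contDiffOn_const.mul (cw1 j)).mul (cw1 i)).sub
        ((contDiffOn_const.mul (ContDiffOn.sum fun j _ => (cw1 j).pow 2)).mul contDiffOn_const)
    have hX1 : ∀ i, ContDiffOn ℝ 1 (fun x => (1 / 2 * τ ^ 2 * ℓ (e i)) * (w x) ^ 2) Ω := fun i =>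
      contDiffOn_const.mul (cw0.pow 2)
    have hdiv : ∀ x ∈ Ω, ∑ i, fderiv ℝ (fun x => (∑ j, V j x * fderiv ℝ w x (e j)) * fderiv ℝ w x (e i)
      - 1 / 2 * (∑ j, fderiv ℝ w x (e j) ^ 2) * V i x + (1 / 2 * τ ^ 2 * ℓ (e i)) * (w x) ^ 2) x (e i) =
       fderiv ℝ w x (e i₀) * (a x * (∑ i, fderiv ℝ (fun y => fderiv ℝ u y (e i)) x (e i)))
      + 2 * τ * fderiv ℝ w x (e i₀) ^ 2 := by
      intro x hx
      have hn := h.isOpen.mem_nhds hx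
      have e2 : ∀ i, fderiv ℝ (fun x => (∑ j, V j x * fderiv ℝ w x (e j)) * fderiv ℝ w x (e i)
        - 1 / 2 * (∑ j, fderiv ℝ w x (e j) ^ 2) * V i x + (1 / 2 * τ ^ 2 * ℓ (e i)) * (w x) ^ 2) x (e i) = 
        fderiv ℝ (fun x => (∑ j, V j x * fderiv ℝ w x (e j)) * fderiv ℝ w x (e i)
        - 1 / 2 * (∑ j, fderiv ℝ w x (e j) ^ 2) * V i x) x (e i) + 
          ℓ (e i) * (τ ^ 2 * w x * fderiv ℝ w x (e i)) := by
        intro i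
        have dw : DifferentiableAt ℝ w x := (cw0.contDiffAt hn).differentiableAt one_ne_zero
        rw [fderiv_fun_add (((hX0 i).contDiffAt hn).differentiableAt one_ne_zero)
          (((hX1 i).contDiffAt hn).differentiableAt one_ne_zero),
          ((dw.hasFDerivAt.pow 2).const_mul (1 / 2 * τ ^ 2 * ℓ (e i))).fderiv]
        simp; ring
      simp only [e2]
      rw [Finset.sum_add_distrib, poh_div (cw.contDiffAt hn) (fun i => differentiableAt_const _), lapw x hx, hVs]
      simp only [hV, hVs]
      simp
      ring
    rw [← setIntegral_congr_fun h.isOpen.measurableSet hdiv]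
    have hb : BC Ω (fun x => fderiv ℝ w x (e i₀) * (a x * (∑ i, fderiv ℝ (fun y => fderiv ℝ u y (e i)) x (e i)))
      + 2 * τ * fderiv ℝ w x (e i₀) ^ 2) :=
      ((bwi i₀).mul (BC.mul ⟨ca.continuous.continuousOn, A, hA⟩ hlap)).add ((BC.const _).mul ((bwi i₀).pow 2))
    -- bound
    have hbd : ∃ K : ℝ, ∀ x ∈ Ω, |∑ i, fderiv ℝ D x (e i) * ((∑ j, V j x * fderiv ℝ w x (e j)) * fderiv ℝ w x (e i)
      - 1 / 2 * (∑ j, fderiv ℝ w x (e j) ^ 2) * V i x + (1 / 2 * τ ^ 2 * ℓ (e i)) * (w x) ^ 2)| ≤ 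
        K * (∑ i, fderiv ℝ u x (e i) ^ 2 + u x ^ 2) := by
      set N : ℝ := (Fintype.card ι : ℝ)
      set K1 : ℝ := A ^ 2 * (2 + 2 * τ ^ 2) with hK1
      refine ⟨∑ i, B i * (K1 + 1 / 2 * (N * K1) + 1 / 2 * τ ^ 2 * A ^ 2), fun x hx => ?_⟩
      set q := ∑ i, fderiv ℝ u x (e i) ^ 2 + u x ^ 2 with hq
      have q0 : 0 ≤ q := by positivity
      have hl1 : ∀ i, ℓ (e i) ^ 2 ≤ 1 := by intro i; rw [hℓ]; split_ifs <;> norm_num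
      have hl2 : ∀ i, |ℓ (e i)| ≤ 1 := by intro i; rw [hℓ]; split_ifs <;> norm_num
      have aA : a x ^ 2 ≤ A ^ 2 := by
        rw [← sq_abs (a x)]; exact pow_le_pow_left₀ (abs_nonneg _) (hA x hx) 2
      have wq : ∀ i, fderiv ℝ w x (e i) ^ 2 ≤ K1 * q := by
        intro i
        have h1 : fderiv ℝ u x (e i) ^ 2 ≤ ∑ i, fderiv ℝ u x (e i) ^ 2 :=
          Finset.single_le_sum (f := fun i => fderiv ℝ u x (e i) ^ 2) (fun i _ => sq_nonneg _) (Finset.mem_univ i)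
        have h2 : (fderiv ℝ u x (e i) + τ * ℓ (e i) * u x) ^ 2 ≤ (2 + 2 * τ ^ 2) * q := by
          have : (fderiv ℝ u x (e i) + τ * ℓ (e i) * u x) ^ 2 ≤ 2 * fderiv ℝ u x (e i) ^ 2 + 2 * (τ ^ 2 * ℓ (e i) ^ 2 * u x ^ 2) := by
            nlinarith [sq_nonneg (fderiv ℝ u x (e i) - τ * ℓ (e i) * u x)]
          have h3 : τ ^ 2 * ℓ (e i) ^ 2 * u x ^ 2 ≤ τ ^ 2 * u x ^ 2 := by
            have := mul_le_mul_of_nonneg_left (hl1 i) (by positivity : 0 ≤ τ ^ 2 * u x ^ 2)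
            linarith
          have h5 : fderiv ℝ u x (e i) ^ 2 ≤ q := by rw [hq]; nlinarith [sq_nonneg (u x)]
          have h6 : u x ^ 2 ≤ q := by rw [hq]; nlinarith [sq_nonneg (fderiv ℝ u x (e i))]
          have h7 := mul_le_mul_of_nonneg_left h6 (sq_nonneg τ)
          linarith
        rw [w1 x hx, mul_pow, hK1, mul_assoc (A ^ 2)]
        exact mul_le_mul aA h2 (sq_nonneg _) (sq_nonneg _)
      have wq0 : w x ^ 2 ≤ A ^ 2 * q := by
        simp only [hw]
        rw [mul_pow]
        refine mul_le_mul aA ?_ (sq_nonneg _) (sq_nonneg _)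
        rw [hq]; have : 0 ≤ ∑ i, fderiv ℝ u x (e i) ^ 2 := by positivity
        linarith
      have ws : ∑ j, fderiv ℝ w x (e j) ^ 2 ≤ N * (K1 * q) := by
        refine (Finset.sum_le_sum fun i _ => wq i).trans ?_
        simp [N]
      refine (Finset.abs_sum_le_sum_abs _ _).trans ?_
      rw [Finset.sum_mul]
      refine Finset.sum_le_sum fun i _ => ?_
      rw [abs_mul, mul_assoc (B i)]
      refine mul_le_mul (hB i x hx) ?_ (abs_nonneg _) ((abs_nonneg _).trans (hB i x hx))
      simp only [hV, hVs]
      have t1 : |fderiv ℝ w x (e i₀) * fderiv ℝ w x (e i)| ≤ K1 * q := by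
        rw [abs_le]
        constructor <;> nlinarith [wq i, wq i₀, sq_nonneg (fderiv ℝ w x (e i₀) - fderiv ℝ w x (e i)), sq_nonneg (fderiv ℝ w x (e i₀) + fderiv ℝ w x (e i))]
      have t2 : |1 / 2 * (∑ j, fderiv ℝ w x (e j) ^ 2) * ℓ (e i)| ≤ 1 / 2 * (N * (K1 * q)) := by
        rw [abs_mul, abs_of_nonneg (by positivity : 0 ≤ 1 / 2 * (∑ j, fderiv ℝ w x (e j) ^ 2))]
        calc _ ≤ 1 / 2 * (∑ j, fderiv ℝ w x (e j) ^ 2) * 1 := by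
              exact mul_le_mul_of_nonneg_left (hl2 i) (by positivity)
          _ ≤ _ := by linarith
      have t3 : |(1 / 2 * τ ^ 2 * ℓ (e i)) * (w x) ^ 2| ≤ 1 / 2 * τ ^ 2 * (A ^ 2 * q) := by
        rw [abs_mul, abs_mul, abs_of_nonneg (by positivity : 0 ≤ 1 / 2 * τ ^ 2), abs_of_nonneg (sq_nonneg (w x))]
        refine mul_le_mul ?_ wq0 (sq_nonneg _) (by positivity)
        exact mul_le_of_le_one_right (by positivity) (hl2 i)
      calc _ ≤ |fderiv ℝ w x (e i₀) * fderiv ℝ w x (e i)| + |1 / 2 * (∑ j, fderiv ℝ w x (e j) ^ 2) * ℓ (e i)|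
            + |(1 / 2 * τ ^ 2 * ℓ (e i)) * (w x) ^ 2| :=
            (abs_add_le _ _).trans (add_le_add (abs_sub _ _) le_rfl)
        _ ≤ _ := by linarith
    obtain ⟨K, hK⟩ := hbd
    exact h.div_zero (fun i => (hX0 i).add (hX1 i)) (int (hb.congr hdiv))
      ((BC.const K).mul (bgr.add (hub.pow 2))) hK (mq K)
  -- identity 2
  have I2 : ∫ x in Ω, (w x ^ 2 + 2 * ℓ x * w x * fderiv ℝ w x (e i₀)) ∂μ = 0 := by
    have hX : ∀ i, ContDiffOn ℝ 1 (fun x => ℓ (e i) * (ℓ x * w x ^ 2)) Ω := fun i =>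
      contDiffOn_const.mul (ℓ.contDiff.contDiffOn.mul (cw0.pow 2))
    have hdiv : ∀ x ∈ Ω, ∑ i, fderiv ℝ (fun x => ℓ (e i) * (ℓ x * w x ^ 2)) x (e i) =
        w x ^ 2 + 2 * ℓ x * w x * fderiv ℝ w x (e i₀) := by
      intro x hx
      have hn := h.isOpen.mem_nhds hx
      have dw : DifferentiableAt ℝ w x := (cw0.contDiffAt hn).differentiableAt one_ne_zero
      have e2 : ∀ i, fderiv ℝ (fun x => ℓ (e i) * (ℓ x * w x ^ 2)) x (e i) =
          ℓ (e i) * (ℓ (e i) * w x ^ 2 + 2 * ℓ x * w x * fderiv ℝ w x (e i)) := by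
        intro i
        simp only [pow_two]
        rw [(((ℓ.hasFDerivAt (x := x)).fun_mul (dw.hasFDerivAt.fun_mul dw.hasFDerivAt)).const_mul (ℓ (e i))).fderiv]
        simp; ring
      simp only [e2, hVs]
      simp [hℓ]
    rw [← setIntegral_congr_fun h.isOpen.measurableSet hdiv]
    have hb : BC Ω (fun x => w x ^ 2 + 2 * ℓ x * w x * fderiv ℝ w x (e i₀)) :=
      (bw.pow 2).add ((((BC.const 2).mul bℓ).mul bw).mul (bwi i₀))
    have hq : BC Ω (fun x => |∑ i, fderiv ℝ D x (e i) * (ℓ (e i) * (ℓ x * w x ^ 2))|) :=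
      (BC.sum _ fun i => (hD i).mul ((BC.const _).mul (bℓ.mul (bw.pow 2)))).abs
    refine h.div_zero hX (int (hb.congr hdiv)) hq (fun x hx => le_rfl) ?_
    refine h.m_tendsto hq (fun x _ => abs_nonneg _) ?_
    have ba' : BC Ω a := ⟨ca.continuous.continuousOn, A, hA⟩
    have := smu.mulBC ((((hD i₀).mul bℓ).mul ba').mul bw)
    intro δ hδ
    obtain ⟨b, hb, h1⟩ := this δ hδ
    refine ⟨b, hb, fun x hx hd => ?_⟩
    convert h1 x hx hd using 2
    have e9 : ∑ i, fderiv ℝ D x (e i) * (ℓ (e i) * (ℓ x * w x ^ 2)) =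
      ∑ i, ℓ (e i) * (fderiv ℝ D x (e i) * (ℓ x * w x ^ 2)) :=
      Finset.sum_congr rfl fun i _ => by ring
    rw [e9, hVs]; simp only [hw]; ring
  -- combine
  have J1 : ∫ x in Ω, w x ^ 2 ∂μ ≤ 4 * L ^ 2 * ∫ x in Ω, fderiv ℝ w x (e i₀) ^ 2 ∂μ := by
    have hmono : ∫ x in Ω, (w x ^ 2 + 2 * ℓ x * w x * fderiv ℝ w x (e i₀)) ∂μ ≥
        ∫ x in Ω, (1 / 2 * w x ^ 2 - 2 * L ^ 2 * fderiv ℝ w x (e i₀) ^ 2) ∂μ := by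
      refine setIntegral_mono_on (int (((BC.const _).mul (bw.pow 2)).sub ((BC.const _).mul ((bwi i₀).pow 2))))
        (int ((bw.pow 2).add ((((BC.const 2).mul bℓ).mul bw).mul (bwi i₀)))) h.isOpen.measurableSet fun x hx => ?_
      have h1 : ℓ x ^ 2 ≤ L ^ 2 := by
        rw [← sq_abs (ℓ x)]; exact pow_le_pow_left₀ (abs_nonneg _) (hℓL x hx) 2
      have h2 := mul_le_mul_of_nonneg_right h1 (sq_nonneg (fderiv ℝ w x (e i₀)))
      nlinarith [sq_nonneg (w x + 2 * ℓ x * fderiv ℝ w x (e i₀))]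
    rw [I2, integral_sub (int ((BC.const _).mul (bw.pow 2))) (int ((BC.const _).mul ((bwi i₀).pow 2))),
      integral_const_mul, integral_const_mul] at hmono
    linarith
  have J2 : 2 * τ * ∫ x in Ω, fderiv ℝ w x (e i₀) ^ 2 ∂μ ≤
      M * L * (∫ x in Ω, fderiv ℝ w x (e i₀) ^ 2 ∂μ) + M / (4 * L) * ∫ x in Ω, w x ^ 2 ∂μ := by
    have ba' : BC Ω a := ⟨ca.continuous.continuousOn, A, hA⟩
    have hmono : ∫ x in Ω, (fderiv ℝ w x (e i₀) * (a x * (∑ i, fderiv ℝ (fun y => fderiv ℝ u y (e i)) x (e i)))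
      + 2 * τ * fderiv ℝ w x (e i₀) ^ 2) ∂μ ≥
        ∫ x in Ω, ((2 * τ - M * L) * fderiv ℝ w x (e i₀) ^ 2 - M / (4 * L) * w x ^ 2) ∂μ := by
      refine setIntegral_mono_on (int (((BC.const _).mul ((bwi i₀).pow 2)).sub ((BC.const _).mul (bw.pow 2))))
        (int (((bwi i₀).mul (ba'.mul hlap)).add ((BC.const _).mul ((bwi i₀).pow 2)))) h.isOpen.measurableSet fun x hx => ?_
      have h1 := hM x hx
      set p := fderiv ℝ w x (e i₀)
      set lp := ∑ i, fderiv ℝ (fun y => fderiv ℝ u y (e i)) x (e i)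
      have h2 : |a x * lp| ≤ M * |w x| := by
        simp only [hw]
        rw [abs_mul, abs_mul]
        calc |a x| * |lp| ≤ |a x| * (M * |u x|) := by gcongr
          _ = _ := by ring
      have h3 : |p * (a x * lp)| ≤ |p| * (M * |w x|) := by
        rw [abs_mul]; gcongr
      have h4 : |p| * (M * |w x|) ≤ M * L * p ^ 2 + M / (4 * L) * w x ^ 2 := by
        have : |p| * |w x| ≤ L * p ^ 2 + 1 / (4 * L) * w x ^ 2 := by
          rw [← sq_abs p, ← sq_abs (w x)]
          have : L * |p| ^ 2 + 1 / (4 * L) * |w x| ^ 2 - |p| * |w x| = 1 / (4 * L) * (2 * L * |p| - |w x|) ^ 2 := by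
            field_simp; ring
          have h9 : 0 ≤ 1 / (4 * L) * (2 * L * |p| - |w x|) ^ 2 := by positivity
          linarith
        calc |p| * (M * |w x|) = M * (|p| * |w x|) := by ring
          _ ≤ M * (L * p ^ 2 + 1 / (4 * L) * w x ^ 2) := by gcongr
          _ = _ := by ring
      have h5 := neg_abs_le (p * (a x * lp))
      linarith
    rw [I1, integral_sub (int ((BC.const _).mul ((bwi i₀).pow 2))) (int ((BC.const _).mul (bw.pow 2))),
      integral_const_mul, integral_const_mul] at hmono
    linarith
  have J3 : M / (4 * L) * ∫ x in Ω, w x ^ 2 ∂μ ≤ M * L * ∫ x in Ω, fderiv ℝ w x (e i₀) ^ 2 ∂μ := by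
    calc _ ≤ M / (4 * L) * (4 * L ^ 2 * ∫ x in Ω, fderiv ℝ w x (e i₀) ^ 2 ∂μ) := by gcongr
      _ = _ := by field_simp
  have J4 : ∫ x in Ω, fderiv ℝ w x (e i₀) ^ 2 ∂μ ≤ 0 := by
    rw [hτ] at J2; nlinarith
  have J5 : ∫ x in Ω, w x ^ 2 ∂μ ≤ 0 := by nlinarith [sq_nonneg L]
  intro x hx
  have := zero_of_int h.isOpen (bw.pow 2).1 (int (bw.pow 2)) (fun x _ => sq_nonneg _) J5 x hx
  have hwx : a x * u x = 0 := by simpa [hw] using this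
  rcases mul_eq_zero.1 hwx with h1 | h1
  · exact absurd h1 (Real.exp_pos _).ne'
  · exact h1

end gen3
end PZ
end

open MeasureTheory

noncomputable section
set_option linter.unusedSectionVars false
set_option linter.unusedVariables false
namespace PZ
open Filter Topology Set

section geo
variable {d q : ℕ}

abbrev XX (d q : ℕ) := EuclideanSpace ℝ (Fin d) × EuclideanSpace ℝ (Fin q)

def DD (r ρ : ℝ) (x : XX d q) : ℝ := r ^ 2 - (‖x.1‖ - ρ) ^ 2 - ‖x.2‖ ^ 2
def OO (d q : ℕ) (r ρ : ℝ) : Set (XX d q) := {x | 0 < DD r ρ x}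
def ee (d q : ℕ) : Fin d ⊕ Fin q → XX d q :=
  Sum.elim (fun i => (EuclideanSpace.single i 1, 0)) (fun j => (0, EuclideanSpace.single j 1))
def WW (d q : ℕ) : Set (XX d q) := {x | x.1 ≠ 0}
def χ (s : ℝ) : ℝ := Real.smoothTransition (s - 1)
def ηη (r ρ : ℝ) (ε : ℝ) (x : XX d q) : ℝ := χ (DD r ρ x / ε)
def mm (r ρ : ℝ) (ε : ℝ) (x : XX d q) : ℝ := deriv χ (DD r ρ x / ε) / ε

instance haar : (volume : Measure (XX d q)).IsAddHaarMeasure := Measure.prod.instIsAddHaarMeasure _ _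

lemma χ_cd : ContDiff ℝ 1 χ := by
  unfold χ
  exact (Real.smoothTransition.contDiff (n := 1)).comp (contDiff_id.sub contDiff_const)

lemma χ_nonneg (s : ℝ) : 0 ≤ χ s := Real.smoothTransition.nonneg _
lemma χ_le (s : ℝ) : χ s ≤ 1 := Real.smoothTransition.le_one _
lemma χ_one {s : ℝ} (h : 2 ≤ s) : χ s = 1 := Real.smoothTransition.one_of_one_le (by linarith)
lemma χ_zero {s : ℝ} (h : s ≤ 1) : χ s = 0 := Real.smoothTransition.zero_of_nonpos (by linarith)
lemma χ_mono : Monotone χ := fun a b h => Real.smoothTransition.monotone (by linarith)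
lemma χd_nonneg (s : ℝ) : 0 ≤ deriv χ s := χ_mono.deriv_nonneg
lemma χd_zero {s : ℝ} (h : 2 ≤ s) : deriv χ s = 0 := by
  have : IsLocalMax χ s := Eventually.of_forall fun y => by rw [χ_one h]; exact χ_le y
  exact this.deriv_eq_zero
lemma χd_zero' {s : ℝ} (h : s ≤ 1) : deriv χ s = 0 := by
  have : IsLocalMin χ s := Eventually.of_forall fun y => by rw [χ_zero h]; exact χ_nonneg y
  exact this.deriv_eq_zero
lemma χd_cont : Continuous (deriv χ) := χ_cd.continuous_deriv le_rfl
lemma χd_bdd : ∃ K, 0 ≤ K ∧ ∀ s, deriv χ s ≤ K := by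
  obtain ⟨K, hK⟩ := (isCompact_Icc (a := (1:ℝ)) (b := 2)).exists_bound_of_continuousOn χd_cont.continuousOn
  refine ⟨|K|, abs_nonneg _, fun s => ?_⟩
  by_cases h1 : s ≤ 1
  · rw [χd_zero' h1]; positivity
  by_cases h2 : 2 ≤ s
  · rw [χd_zero h2]; positivity
  · push Not at h1 h2
    exact (le_abs_self _).trans ((hK s ⟨h1.le, h2.le⟩).trans (le_abs_self _))

variable {r ρ : ℝ}

lemma DD_cont : Continuous (DD r ρ : XX d q → ℝ) := by unfold DD; fun_prop
lemma OO_open : IsOpen (OO d q r ρ) := isOpen_lt continuous_const DD_cont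
lemma WW_open : IsOpen (WW d q) := isOpen_ne_fun continuous_fst continuous_const

lemma neg_of (hr : 0 < r) (hρ : r < ρ) {x : XX d q} (hx : x.1 = 0) : DD r ρ x < 0 := by
  unfold DD; rw [hx]; simp; nlinarith [sq_nonneg ‖x.2‖]

lemma nonneg_WW (hr : 0 < r) (hρ : r < ρ) {x : XX d q} (hx : 0 ≤ DD r ρ x) : x ∈ WW d q := by
  intro h; linarith [neg_of hr hρ h]

lemma clos : closure (OO d q r ρ) ⊆ {x | 0 ≤ DD r ρ x} :=
  closure_minimal (fun x (hx : 0 < DD r ρ x) => (le_of_lt hx : 0 ≤ DD r ρ x)) (isClosed_le continuous_const DD_cont)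

lemma t_bound (hr : 0 < r) {x : XX d q} (hx : 0 ≤ DD r ρ x) : |‖x.1‖ - ρ| ≤ r ∧ ‖x.2‖ ≤ r := by
  unfold DD at hx
  exact ⟨abs_le_of_sq_le_sq (by nlinarith [sq_nonneg ‖x.2‖]) hr.le,
    abs_le_of_sq_le_sq' (by nlinarith [sq_nonneg (‖x.1‖ - ρ)]) hr.le |>.2⟩

lemma cpt_nonneg (hr : 0 < r) (hρ : r < ρ) : IsCompact {x : XX d q | 0 ≤ DD r ρ x} := by
  refine (isCompact_closedBall (0 : XX d q) (ρ + r)).of_isClosed_subset (isClosed_le continuous_const DD_cont) ?_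
  intro x hx
  obtain ⟨h1, h2⟩ := t_bound hr hx
  rw [abs_le] at h1
  rw [mem_closedBall_zero_iff, Prod.norm_def]
  exact max_le (by linarith) (by linarith)

lemma cpt_clos (hr : 0 < r) (hρ : r < ρ) : IsCompact (closure (OO d q r ρ)) :=
  (cpt_nonneg hr hρ).of_isClosed_subset isClosed_closure clos

lemma OO_WW (hr : 0 < r) (hρ : r < ρ) : OO d q r ρ ⊆ WW d q := fun _ hx => nonneg_WW hr hρ (le_of_lt hx)
lemma clos_WW (hr : 0 < r) (hρ : r < ρ) : closure (OO d q r ρ) ⊆ WW d q :=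
  fun _ hx => nonneg_WW hr hρ (clos hx)

lemma OO_fin (hr : 0 < r) (hρ : r < ρ) : (volume : Measure (XX d q)) (OO d q r ρ) < ⊤ := by
  exact (measure_mono subset_closure).trans_lt (cpt_clos hr hρ).measure_lt_top

lemma norm_cd {n : WithTop ℕ∞} : ContDiffOn ℝ n (fun x : XX d q => ‖x.1‖) (WW d q) := fun x hx =>
  (contDiffAt_fst.norm ℝ hx).contDiffWithinAt

lemma DD_cd {n : WithTop ℕ∞} : ContDiffOn ℝ n (DD r ρ : XX d q → ℝ) (WW d q) := by
  unfold DD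
  exact (contDiffOn_const.sub ((norm_cd.sub contDiffOn_const).pow 2)).sub
    (contDiff_snd.norm_sq ℝ).contDiffOn

lemma norm_fd {x : XX d q} (hx : x.1 ≠ 0) :
    HasFDerivAt (fun x : XX d q => ‖x.1‖)
      (‖x.1‖⁻¹ • (innerSL ℝ x.1).comp (ContinuousLinearMap.fst ℝ _ _)) x := by
  have h := ((hasFDerivAt_fst (𝕜 := ℝ) (p := x)).norm_sq).sqrt (by simpa using hx)
  simp only [Real.sqrt_sq (norm_nonneg _)] at h
  refine h.congr_fderiv (ContinuousLinearMap.ext fun v => ?_)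
  have ht : ‖x.1‖ ≠ 0 := by simpa using hx
  simp
  field_simp

lemma DD_fd {x : XX d q} (hx : x.1 ≠ 0) (v : XX d q) :
    fderiv ℝ (DD r ρ : XX d q → ℝ) x v = -2 * (‖x.1‖ - ρ) / ‖x.1‖ * inner ℝ x.1 v.1 - 2 * inner ℝ x.2 v.2 := by
  have h1 := ((norm_fd hx).sub_const ρ).mul ((norm_fd hx).sub_const ρ)
  have h2 := (hasFDerivAt_snd (𝕜 := ℝ) (p := x)).norm_sq
  have h3 := (h1.const_sub (r ^ 2)).sub h2
  have h4 : HasFDerivAt (DD r ρ : XX d q → ℝ) _ x :=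
    h3.congr_of_eventuallyEq (Eventually.of_forall fun x => by simp [DD]; ring)
  rw [h4.fderiv]
  simp; ring

lemma ee_inl (i : Fin d) : ee d q (Sum.inl i) = (EuclideanSpace.single i 1, 0) := rfl
lemma ee_inr (j : Fin q) : ee d q (Sum.inr j) = (0, EuclideanSpace.single j 1) := rfl

lemma DD_inl {x : XX d q} (hx : x.1 ≠ 0) (i : Fin d) :
    fderiv ℝ (DD r ρ : XX d q → ℝ) x (ee d q (Sum.inl i)) = -2 * (‖x.1‖ - ρ) / ‖x.1‖ * x.1 i := by
  rw [DD_fd hx, ee_inl]; simp [EuclideanSpace.inner_single_right]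
lemma DD_inr {x : XX d q} (hx : x.1 ≠ 0) (j : Fin q) :
    fderiv ℝ (DD r ρ : XX d q → ℝ) x (ee d q (Sum.inr j)) = -2 * x.2 j := by
  rw [DD_fd hx, ee_inr]; simp [EuclideanSpace.inner_single_right]

lemma nsq {n : ℕ} (y : EuclideanSpace ℝ (Fin n)) : ∑ i, y i ^ 2 = ‖y‖ ^ 2 := by
  rw [EuclideanSpace.norm_sq_eq]; simp

lemma DD_sq {x : XX d q} (hx : x.1 ≠ 0) :
    ∑ i, fderiv ℝ (DD r ρ : XX d q → ℝ) x (ee d q i) ^ 2 = 4 * (r ^ 2 - DD r ρ x) := by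
  have ht : ‖x.1‖ ≠ 0 := by simpa using hx
  rw [Fintype.sum_sum_type]
  simp only [DD_inl hx, DD_inr hx, mul_pow, ← Finset.mul_sum, nsq, DD]
  field_simp
  ring

lemma BC_DD (hr : 0 < r) (hρ : r < ρ) (v : XX d q) :
    BC (OO d q r ρ) (fun x => fderiv ℝ (DD r ρ) x v) :=
  BC.of_closure (cpt_clos hr hρ)
    (((c1_partial WW_open DD_cd v).continuousOn).mono (clos_WW hr hρ))

lemma BC_DD2 (hr : 0 < r) (hρ : r < ρ) (v w : XX d q) :
    BC (OO d q r ρ) (fun x => fderiv ℝ (fun y => fderiv ℝ (DD r ρ) y v) x w) :=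
  BC.of_closure (cpt_clos hr hρ)
    ((((c1_partial WW_open DD_cd v).continuousOn_fderiv_of_isOpen WW_open le_rfl).clm_apply
      continuousOn_const).mono (clos_WW hr hρ))

lemma η_smooth (hr : 0 < r) (hρ : r < ρ) {ε : ℝ} (hε : 0 < ε) : ContDiff ℝ 1 (ηη r ρ ε : XX d q → ℝ) := by
  rw [contDiff_iff_contDiffAt]
  intro x
  by_cases hx : x.1 = 0
  · refine (contDiffAt_const (c := (0:ℝ))).congr_of_eventuallyEq ?_
    filter_upwards [(isOpen_lt DD_cont continuous_const).mem_nhds (neg_of hr hρ hx : x ∈ {x : XX d q | DD r ρ x < 0})] with y hy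
    exact χ_zero ((div_nonpos_of_nonpos_of_nonneg (le_of_lt hy) hε.le).trans zero_le_one)
  · exact χ_cd.contDiffAt.comp x ((DD_cd.contDiffAt (WW_open.mem_nhds hx)).div_const ε)

lemma η_supp {ε : ℝ} (hε : 0 < ε) : tsupport (ηη r ρ ε : XX d q → ℝ) ⊆ {x | ε ≤ DD r ρ x} := by
  refine closure_minimal (fun x hx => ?_) (isClosed_le continuous_const DD_cont)
  by_contra h
  exact hx (χ_zero (by rw [div_le_one hε]; exact (not_le.1 h).le))

lemma η_deriv (hr : 0 < r) (hρ : r < ρ) {ε : ℝ} {x : XX d q} (hx : x ∈ OO d q r ρ) :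
    fderiv ℝ (ηη r ρ ε) x = mm r ρ ε x • fderiv ℝ (DD r ρ) x := by
  have hD : HasFDerivAt (DD r ρ) (fderiv ℝ (DD r ρ) x) x :=
    ((DD_cd (n := 1)).contDiffAt (WW_open.mem_nhds (OO_WW hr hρ hx))).differentiableAt one_ne_zero |>.hasFDerivAt
  have h2 : HasDerivAt (fun s => χ (s / ε)) (mm r ρ ε x) (DD r ρ x) := by
    have := (χ_cd.differentiable one_ne_zero (DD r ρ x / ε)).hasDerivAt.comp (DD r ρ x) ((hasDerivAt_id (DD r ρ x)).div_const ε)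
    rw [mul_one_div] at this
    exact this
  exact (h2.comp_hasFDerivAt x hD).fderiv

lemma mm_nonneg {ε : ℝ} (hε : 0 < ε) (x : XX d q) : 0 ≤ mm r ρ ε x := div_nonneg (χd_nonneg _) hε.le

lemma mm_supp {ε : ℝ} (hε : 0 < ε) {x : XX d q} (h : 2 * ε ≤ DD r ρ x) : mm r ρ ε x = 0 := by
  unfold mm; rw [χd_zero (by rwa [le_div_iff₀ hε]), zero_div]

lemma mm_BC {ε : ℝ} (hε : 0 < ε) : BC (OO d q r ρ) (mm r ρ ε) := by
  obtain ⟨K, hK0, hK⟩ := χd_bdd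
  refine ⟨((χd_cont.comp (DD_cont.div_const ε)).div_const ε).continuousOn, K / ε, fun x _ => ?_⟩
  rw [abs_of_nonneg (mm_nonneg hε x)]
  unfold mm; gcongr; exact hK _

lemma m_total (hr : 0 < r) (hρ : r < ρ) : ∃ C, 0 ≤ C ∧ ∀ᶠ ε in 𝓝[>] (0:ℝ), ∫ x in OO d q r ρ, mm r ρ ε x ≤ C := by
  obtain ⟨_, K, hK⟩ := BC.sum Finset.univ (fun i => BC_DD2 hr hρ (ee d q i) (ee d q i))
  refine ⟨|K| * (volume (OO d q r ρ)).toReal / (2 * r ^ 2), by positivity, ?_⟩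
  filter_upwards [Ioo_mem_nhdsGT (show (0:ℝ) < r ^ 2 / 4 by positivity)] with ε hε
  obtain ⟨hε, hε2⟩ := hε
  have cptη : HasCompactSupport (ηη r ρ ε : XX d q → ℝ) :=
    (cpt_nonneg hr hρ).of_isClosed_subset (isClosed_tsupport _)
      ((η_supp hε).trans fun x hx => hε.le.trans hx)
  have supη : tsupport (ηη r ρ ε) ⊆ OO d q r ρ := (η_supp hε).trans fun x hx => lt_of_lt_of_le hε hx
  have hX : ∀ i, ContDiffOn ℝ 1 (fun x => fderiv ℝ (DD r ρ) x (ee d q i)) (OO d q r ρ) := fun i =>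
    (c1_partial WW_open DD_cd _).mono (OO_WW hr hρ)
  have hsm := η_smooth (d := d) (q := q) hr hρ hε
  have e2 : ∀ x ∈ OO d q r ρ, mm r ρ ε x * ∑ i, fderiv ℝ (DD r ρ) x (ee d q i) * fderiv ℝ (DD r ρ) x (ee d q i) =
      ∑ i, fderiv ℝ (ηη r ρ ε) x (ee d q i) * fderiv ℝ (DD r ρ) x (ee d q i) := by
    intro x hx
    rw [Finset.mul_sum]
    refine Finset.sum_congr rfl fun i _ => ?_
    rw [η_deriv hr hρ hx]; simp [mul_assoc]
  have key : ∫ x in OO d q r ρ, ηη r ρ ε x * ∑ i, fderiv ℝ (fun y => fderiv ℝ (DD r ρ) y (ee d q i)) x (ee d q i) =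
      - ∫ x in OO d q r ρ, mm r ρ ε x * ∑ i, fderiv ℝ (DD r ρ) x (ee d q i) * fderiv ℝ (DD r ρ) x (ee d q i) := by
    rw [setIntegral_congr_fun OO_open.measurableSet e2]
    simp_rw [Finset.mul_sum]
    rw [integral_finsetSum, integral_finsetSum, ← Finset.sum_neg_distrib]
    · exact Finset.sum_congr rfl fun i _ => ibp OO_open hsm cptη supη (hX i) (ee d q i)
    · intro i _
      refine Integrable.integrableOn ?_
      refine integrable_cut OO_open
        ((hsm.continuous_fderiv one_ne_zero).clm_apply continuous_const)
        (cptη.fderiv_apply ℝ _) ((tsupport_fderiv_apply_subset ℝ _).trans supη) (hX i).continuousOn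
    · intro i _
      refine Integrable.integrableOn ?_
      exact integrable_cut OO_open hsm.continuous cptη supη
        (((hX i).continuousOn_fderiv_of_isOpen OO_open le_rfl).clm_apply continuousOn_const)
  have b1 : |∫ x in OO d q r ρ, ηη r ρ ε x * ∑ i, fderiv ℝ (fun y => fderiv ℝ (DD r ρ) y (ee d q i)) x (ee d q i)|
      ≤ |K| * (volume (OO d q r ρ)).toReal := by
    rw [← Real.norm_eq_abs]
    refine norm_setIntegral_le_of_norm_le_const (OO_fin hr hρ) fun x hx => ?_
    rw [norm_mul, Real.norm_of_nonneg (show 0 ≤ ηη r ρ ε x from χ_nonneg _)]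
    refine (mul_le_of_le_one_left (norm_nonneg _) (χ_le _)).trans ((hK x hx).trans (le_abs_self _))
  have b2 : 2 * r ^ 2 * ∫ x in OO d q r ρ, mm r ρ ε x ≤
      ∫ x in OO d q r ρ, mm r ρ ε x * ∑ i, fderiv ℝ (DD r ρ) x (ee d q i) * fderiv ℝ (DD r ρ) x (ee d q i) := by
    rw [← integral_const_mul]
    refine setIntegral_mono_on (((BC.const _).mul (mm_BC hε)).integrableOn OO_open (OO_fin hr hρ))
      (((mm_BC hε).mul (BC.sum _ fun i => (BC_DD hr hρ _).mul (BC_DD hr hρ _))).integrableOn OO_open (OO_fin hr hρ))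
      OO_open.measurableSet fun x hx => ?_
    simp only [← pow_two]
    rw [DD_sq (OO_WW hr hρ hx)]
    by_cases hd : 2 * ε ≤ DD r ρ x
    · rw [mm_supp hε hd]; simp
    · nlinarith [mm_nonneg (r := r) (ρ := ρ) hε x]
  rw [key, abs_neg] at b1
  rw [le_div_iff₀ (by positivity)]
  linarith [le_abs_self (∫ x in OO d q r ρ, mm r ρ ε x * ∑ i, fderiv ℝ (DD r ρ) x (ee d q i) * fderiv ℝ (DD r ρ) x (ee d q i))]

lemma cut (hr : 0 < r) (hρ : r < ρ) : Cut volume (OO d q r ρ) (DD r ρ) (ηη r ρ) (mm r ρ) where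
  isOpen := OO_open
  fin := OO_fin hr hρ
  pos := fun x hx => hx
  smooth := fun ε hε => η_smooth hr hρ hε
  cpt := fun ε hε => (cpt_nonneg hr hρ).of_isClosed_subset (isClosed_tsupport _)
      ((η_supp hε).trans fun x hx => (le_of_lt hε).trans hx)
  supp := fun ε hε => (η_supp hε).trans fun x hx => lt_of_lt_of_le hε hx
  nonneg := fun ε x => χ_nonneg _
  le_one := fun ε x => χ_le _
  tends := by
    intro x hx
    refine tendsto_const_nhds.congr' ?_
    have hx' : 0 < DD r ρ x := hx
    filter_upwards [Ioo_mem_nhdsGT (show (0:ℝ) < DD r ρ x / 2 by linarith)] with ε hε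
    exact (χ_one (by rw [le_div_iff₀ hε.1]; linarith [hε.2])).symm
  deriv := fun ε hε x hx => η_deriv hr hρ hx
  m_nonneg := fun ε hε x => mm_nonneg hε x
  m_supp := fun ε hε x hx => mm_supp hε hx
  m_cont := fun ε hε => (mm_BC hε).1
  m_int := fun ε hε => (mm_BC hε).integrableOn OO_open (OO_fin hr hρ)
  mD := by
    obtain ⟨K, hK0, hK⟩ := χd_bdd
    refine ⟨2 * K, fun ε hε x hx => ?_⟩
    by_cases hd : 2 * ε ≤ DD r ρ x
    · rw [mm_supp hε hd]; simpa using hK0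
    · push Not at hd
      have hx' : 0 < DD r ρ x := hx
      have h1 : mm r ρ ε x * ε ≤ K := by
        unfold mm; rw [div_mul_cancel₀ _ (ne_of_gt hε)]; exact hK _
      have := mul_le_mul_of_nonneg_left hd.le (mm_nonneg (r := r) (ρ := ρ) hε x)
      linarith
  m_tot := m_total hr hρ

end geo
end PZ
end

open MeasureTheory

noncomputable section
set_option linter.unusedSectionVars false
set_option linter.unusedVariables false
namespace PZ
open Filter Topology Set

section bdry
variable {d q : ℕ} {r ρ : ℝ}

lemma ray_D {x : XX d q} (hρ : 0 < ρ) (hx : x.1 ≠ 0) {σ R : ℝ} (hσ : 0 ≤ σ) (hR : 0 ≤ R)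
    (hR2 : R ^ 2 = r ^ 2 - DD r ρ x) (hrR : (1 + σ) * R ≤ ρ) :
    DD r ρ (x + σ • ((((‖x.1‖ - ρ) / ‖x.1‖) • x.1, x.2) : XX d q)) = r ^ 2 - (1 + σ) ^ 2 * R ^ 2 := by
  have ht : 0 < ‖x.1‖ := by simpa using hx
  set s := ‖x.1‖ - ρ with hs
  have hsR : |s| ≤ R := by
    apply abs_le_of_sq_le_sq _ hR
    rw [hR2]; unfold DD; nlinarith [sq_nonneg ‖x.2‖]
  have h1 : x.1 + σ • ((s / ‖x.1‖) • x.1) = (1 + σ * (s / ‖x.1‖)) • x.1 := by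
    rw [add_smul, one_smul, smul_smul]
  have h2 : x.2 + σ • x.2 = (1 + σ) • x.2 := by rw [add_smul, one_smul]
  have h3 : (1 + σ * (s / ‖x.1‖)) * ‖x.1‖ = ‖x.1‖ + σ * s := by field_simp
  have h4 : 0 ≤ ‖x.1‖ + σ * s := by
    have : -((1 + σ) * R) ≤ (1 + σ) * s := by
      nlinarith [neg_abs_le s]
    linarith
  have h5 : 0 ≤ 1 + σ * (s / ‖x.1‖) := by
    rw [← h3] at h4; exact nonneg_of_mul_nonneg_left h4 ht
  have e1 : ‖(x + σ • (((s / ‖x.1‖) • x.1, x.2) : XX d q)).1‖ = ‖x.1‖ + σ * s := by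
    simp only [Prod.fst_add, Prod.smul_fst]
    rw [h1, norm_smul, Real.norm_of_nonneg h5, h3]
  have e2 : ‖(x + σ • (((s / ‖x.1‖) • x.1, x.2) : XX d q)).2‖ = (1 + σ) * ‖x.2‖ := by
    simp only [Prod.snd_add, Prod.smul_snd]
    rw [h2, norm_smul, Real.norm_of_nonneg (by linarith)]
  have e3 : R ^ 2 = s ^ 2 + ‖x.2‖ ^ 2 := by rw [hR2]; unfold DD; ring
  rw [DD, e1, e2, e3]
  have : ‖x.1‖ + σ * s - ρ = (1 + σ) * s := by rw [hs]; ring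
  rw [this]; ring

lemma u_le_D (hr : 0 < r) (hρ : r < ρ) {u : XX d q → ℝ} (hu : ∀ x ∈ OO d q r ρ, DifferentiableAt ℝ u x)
    (huc : ContinuousOn u (closure (OO d q r ρ))) (hb : ∀ x ∈ frontier (OO d q r ρ), u x = 0)
    {G : ℝ} (hG : ∀ x ∈ OO d q r ρ, ‖fderiv ℝ u x‖ ≤ G) :
    ∃ C, 0 ≤ C ∧ ∀ x ∈ OO d q r ρ, |u x| ≤ C * DD r ρ x := by
  obtain ⟨_, U, hU⟩ := BC.of_closure (cpt_clos hr hρ) huc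
  refine ⟨2 * |U| / r ^ 2 + 2 * |G| / r, by positivity, fun x hx => ?_⟩
  have hD : 0 < DD r ρ x := hx
  have hx1 := OO_WW hr hρ hx
  by_cases h : r ^ 2 / 2 ≤ DD r ρ x
  · have h1 : |U| ≤ 2 * |U| / r ^ 2 * DD r ρ x := by
      rw [div_mul_eq_mul_div, le_div_iff₀ (by positivity)]
      nlinarith [abs_nonneg U]
    have h2 : 0 ≤ 2 * |G| / r * DD r ρ x := by positivity
    linarith [hU x hx, le_abs_self U]
  · push Not at h
    set R := √(r ^ 2 - DD r ρ x) with hR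
    have hR2 : R ^ 2 = r ^ 2 - DD r ρ x := Real.sq_sqrt (by nlinarith)
    have hR0 : 0 ≤ R := Real.sqrt_nonneg _
    have hRr : R < r := lt_of_pow_lt_pow_left₀ 2 hr.le (by linarith)
    have hRh : r / 2 < R := lt_of_pow_lt_pow_left₀ 2 hR0 (by nlinarith)
    have hRp : 0 < R := by linarith
    have hs : 0 < r / R - 1 := by rw [sub_pos, lt_div_iff₀ hRp]; linarith
    have hb1 := t_bound hr hD.le
    have ht : 0 < ‖x.1‖ := norm_pos_iff.2 hx1
    have hn : ‖((((‖x.1‖ - ρ) / ‖x.1‖) • x.1, x.2) : XX d q)‖ ≤ r := by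
      rw [Prod.norm_def]
      refine max_le ?_ hb1.2
      simp only [norm_smul, norm_div, norm_norm]
      rw [div_mul_cancel₀ _ ht.ne']
      exact hb1.1
    have key := exit_bound OO_open hu huc hb (x := x) (n := (((‖x.1‖ - ρ) / ‖x.1‖) • x.1, x.2)) (M := |G| * r) hs ?_ ?_ ?_
    · refine key.trans ?_
      have h1 : r / R - 1 ≤ 2 * DD r ρ x / r ^ 2 := by
        have : r / R - 1 = DD r ρ x / (R * (r + R)) := by
          rw [show DD r ρ x = (r - R) * (r + R) by nlinarith]; field_simp
        rw [this, div_le_div_iff₀ (by positivity) (by positivity)]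
        have : r ^ 2 ≤ 2 * (R * (r + R)) := by nlinarith
        nlinarith
      have h2 : 0 ≤ 2 * |U| / r ^ 2 * DD r ρ x := by positivity
      have h3 : |G| * r * (r / R - 1) ≤ |G| * r * (2 * DD r ρ x / r ^ 2) := by gcongr
      have h4 : |G| * r * (2 * DD r ρ x / r ^ 2) = 2 * |G| / r * DD r ρ x := by field_simp
      linarith
    · rintro σ ⟨h0, h1⟩
      have h2 : (1 + σ) * R < r := by
        rw [lt_sub_iff_add_lt, lt_div_iff₀ hRp] at h1; linarith
      show 0 < DD r ρ _
      rw [ray_D (hr.trans hρ) hx1 h0 hR0 hR2 (by linarith)]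
      have : ((1 + σ) * R) ^ 2 < r ^ 2 := pow_lt_pow_left₀ h2 (by positivity) two_ne_zero
      nlinarith
    · show ¬ (0 < DD r ρ _)
      have h2 : (1 + (r / R - 1)) * R = r := by field_simp; ring
      rw [ray_D (hr.trans hρ) hx1 hs.le hR0 hR2 (by linarith), ← mul_pow, h2]
      simp
    · intro y hy
      refine ((fderiv ℝ u y).le_opNorm _).trans ?_
      exact mul_le_mul ((hG y hy).trans (le_abs_self _)) hn (norm_nonneg _) (abs_nonneg _)

lemma DD_tan (hr : 0 < r) (hρ : r < ρ) {x T : XX d q} (hx : 0 < DD r ρ x) (hT : ‖T‖ ≤ 1)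
    (h0 : fderiv ℝ (DD r ρ) x T = 0) (h : ℝ) :
    DD r ρ x - 2 * h ^ 2 ≤ DD r ρ (x + h • T) ∧ DD r ρ (x + h • T) ≤ DD r ρ x + h ^ 2 * (ρ / (ρ - r)) := by
  have hx1 : x.1 ≠ 0 := nonneg_WW hr hρ hx.le
  have ht : 0 < ‖x.1‖ := by simpa using hx1
  have hb := t_bound hr hx.le
  have hta : ρ - r ≤ ‖x.1‖ := by linarith [(abs_le.1 hb.1).1]
  rw [DD_fd hx1] at h0
  rw [Prod.norm_def, max_le_iff] at hT
  have hT1 : ‖T.1‖ ^ 2 ≤ 1 := by nlinarith [norm_nonneg T.1]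
  have hT2 : ‖T.2‖ ^ 2 ≤ 1 := by nlinarith [norm_nonneg T.2]
  set t := ‖x.1‖ with htd
  set a := inner ℝ x.1 T.1 with ha
  set b := inner ℝ x.2 T.2 with hb'
  set w := ‖x.1 + h • T.1‖ with hw
  have e1 : w ^ 2 = t ^ 2 + 2 * h * a + h ^ 2 * ‖T.1‖ ^ 2 := by
    rw [hw, norm_add_sq_real, inner_smul_right, norm_smul, mul_pow]; simp; ring
  have e2 : ‖x.2 + h • T.2‖ ^ 2 = ‖x.2‖ ^ 2 + 2 * h * b + h ^ 2 * ‖T.2‖ ^ 2 := by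
    rw [norm_add_sq_real, inner_smul_right, norm_smul, mul_pow]; simp; ring
  have e3 : t ^ 2 + h * a ≤ t * w := by
    have := real_inner_le_norm x.1 (x.1 + h • T.1)
    rw [inner_add_right, inner_smul_right, real_inner_self_eq_norm_sq] at this
    exact this
  have hρ0 : 0 < ρ := hr.trans hρ
  have l1 : t + h * a / t ≤ w := by
    have : t + h * a / t = (t ^ 2 + h * a) / t := by field_simp
    rw [this, div_le_iff₀ ht]; linarith
  have l2 : w ≤ (w ^ 2 / t + t) / 2 := by
    have : (w ^ 2 / t + t) / 2 - w = (w - t) ^ 2 / (2 * t) := by field_simp; ring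
    have : 0 ≤ (w - t) ^ 2 / (2 * t) := by positivity
    linarith
  have eD : DD r ρ (x + h • T) = r ^ 2 - (w - ρ) ^ 2 - ‖x.2 + h • T.2‖ ^ 2 := rfl
  have eD0 : DD r ρ x = r ^ 2 - (t - ρ) ^ 2 - ‖x.2‖ ^ 2 := rfl
  have h0' : 2 * h * (ρ * a / t - a) - 2 * h * b = 0 := by
    have : -2 * (t - ρ) / t * a = 2 * (ρ * a / t - a) := by field_simp; ring
    rw [this] at h0
    linear_combination h * h0
  rw [eD, eD0, e2]
  have hh : 0 ≤ h ^ 2 := sq_nonneg h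
  have m1 := mul_le_mul_of_nonneg_left hT1 hh
  have m2 := mul_le_mul_of_nonneg_left hT2 hh
  constructor
  · have p1 := mul_le_mul_of_nonneg_left l1 hρ0.le
    have p2 : ρ * (t + h * a / t) = ρ * t + h * (ρ * a / t) := by ring
    nlinarith
  · have p1 := mul_le_mul_of_nonneg_left l2 hρ0.le
    have p2 : ρ * ((w ^ 2 / t + t) / 2) = ρ * t + h * (ρ * a / t) + h ^ 2 * ‖T.1‖ ^ 2 * (ρ / t) / 2 := by
      rw [e1]; field_simp; ring
    have p3 : h ^ 2 * ‖T.1‖ ^ 2 * (ρ / t) ≤ h ^ 2 * (ρ / (ρ - r)) := by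
      have : ρ / t ≤ ρ / (ρ - r) := div_le_div_of_nonneg_left hρ0.le (by linarith) hta
      have h7 : 0 ≤ ρ / t := by positivity
      calc h ^ 2 * ‖T.1‖ ^ 2 * (ρ / t) ≤ h ^ 2 * (ρ / t) := by nlinarith
        _ ≤ _ := by gcongr
    have p4 : 0 ≤ h ^ 2 * ‖T.1‖ ^ 2 := by positivity
    have p5 : 0 ≤ h ^ 2 * ‖T.2‖ ^ 2 := by positivity
    have q1 : (w - ρ) ^ 2 = w ^ 2 - 2 * (ρ * w) + ρ ^ 2 := by ring
    have q2 : (t - ρ) ^ 2 = t ^ 2 - 2 * (ρ * t) + ρ ^ 2 := by ring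
    rw [q1, q2]
    rw [p2] at p1
    linarith

lemma tan_small (hr : 0 < r) (hρ : r < ρ) {u : XX d q → ℝ} (hu : ∀ x ∈ OO d q r ρ, DifferentiableAt ℝ u x)
    {g : XX d q → (XX d q →L[ℝ] ℝ)} (hg : ContinuousOn g (closure (OO d q r ρ)))
    (hgu : ∀ x ∈ OO d q r ρ, g x = fderiv ℝ u x)
    {C : ℝ} (hC0 : 0 ≤ C) (hC : ∀ x ∈ OO d q r ρ, |u x| ≤ C * DD r ρ x) {δ : ℝ} (hδ : 0 < δ) :
    ∃ ε₀ > 0, ∀ x ∈ OO d q r ρ, DD r ρ x < ε₀ → ∀ T : XX d q, ‖T‖ ≤ 1 → fderiv ℝ (DD r ρ) x T = 0 →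
      |fderiv ℝ u x T| ≤ δ := by
  have huc := (cpt_clos hr hρ).uniformContinuousOn_of_continuous hg
  rw [Metric.uniformContinuousOn_iff] at huc
  obtain ⟨δ', hδ', huc⟩ := huc (δ / 2) (by positivity)
  set K := ρ / (ρ - r) with hK
  have hK0 : 0 < K := div_pos (hr.trans hρ) (by linarith)
  set C' := 2 * (C * (2 + K)) with hC'
  have hC'0 : 0 ≤ C' := by positivity
  refine ⟨min (δ' ^ 2) ((δ / (2 * (C' + 1))) ^ 2), by positivity, fun x hx hd T hT h0 => ?_⟩
  have hD : 0 < DD r ρ x := hx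
  set w := √(DD r ρ x) with hw
  have hw0 : 0 < w := Real.sqrt_pos.2 hD
  have hw2 : w ^ 2 = DD r ρ x := Real.sq_sqrt hD.le
  have hw1 : w < δ' := lt_of_pow_lt_pow_left₀ 2 hδ'.le (by rw [hw2]; exact hd.trans_le (min_le_left _ _))
  have hw3 : w < δ / (2 * (C' + 1)) :=
    lt_of_pow_lt_pow_left₀ 2 (by positivity) (by rw [hw2]; exact hd.trans_le (min_le_right _ _))
  have hin : ∀ σ ∈ Icc 0 (w / 2), x + σ • T ∈ OO d q r ρ := by
    rintro σ ⟨h1, h2⟩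
    have := (DD_tan hr hρ hD hT h0 σ).1
    show 0 < DD r ρ _
    have : σ ^ 2 ≤ (w / 2) ^ 2 := pow_le_pow_left₀ h1 h2 2
    nlinarith
  have hder : ∀ σ ∈ Icc 0 (w / 2), HasDerivAt (fun σ : ℝ => u (x + σ • T)) (fderiv ℝ u (x + σ • T) T) σ := by
    intro σ hσ
    have h1 : HasDerivAt (fun σ : ℝ => x + σ • T) T σ := by
      simpa using ((hasDerivAt_id σ).smul_const T).const_add x
    exact (hu _ (hin σ hσ)).hasFDerivAt.comp_hasDerivAt σ h1
  obtain ⟨ξ, hξ, hξe⟩ := exists_hasDerivAt_eq_slope (fun σ : ℝ => u (x + σ • T)) (fun σ => fderiv ℝ u (x + σ • T) T)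
    (show (0:ℝ) < w / 2 by positivity) (fun σ hσ => (hder σ hσ).continuousAt.continuousWithinAt)
    (fun σ hσ => hder σ (Ioo_subset_Icc_self hσ))
  have hξ' : ξ ∈ Icc 0 (w / 2) := Ioo_subset_Icc_self hξ
  have hend : w / 2 ∈ Icc 0 (w / 2) := ⟨by positivity, le_rfl⟩
  have b1 : |fderiv ℝ u (x + ξ • T) T| ≤ C' * w := by
    rw [hξe, abs_div, sub_zero, abs_of_pos (show (0:ℝ) < w / 2 by positivity), div_le_iff₀ (by positivity)]
    have h1 := hC _ (hin _ hend)
    have h2 := hC x hx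
    have h3 := (DD_tan hr hρ hD hT h0 (w / 2)).2
    have h4 : |u (x + (w / 2) • T) - u (x + (0:ℝ) • T)| ≤ |u (x + (w / 2) • T)| + |u x| := by
      rw [zero_smul, add_zero]; exact abs_sub _ _
    have h5 := mul_le_mul_of_nonneg_left h3 hC0
    have h6 : C' * w * (w / 2) = C * (2 + K) * DD r ρ x := by rw [← hw2, hC']; ring
    rw [h6]
    have h7 : C * (DD r ρ x + (w / 2) ^ 2 * K) ≤ C * (1 + K) * DD r ρ x := by
      rw [← hw2, mul_assoc]
      apply mul_le_mul_of_nonneg_left _ hC0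
      nlinarith [sq_nonneg w, mul_nonneg hK0.le (sq_nonneg w)]
    nlinarith
  have b2 : dist (g x) (g (x + ξ • T)) < δ / 2 := by
    refine huc x (subset_closure hx) _ (subset_closure (hin ξ hξ')) ?_
    rw [dist_eq_norm]
    have : x - (x + ξ • T) = -(ξ • T) := by abel
    rw [this, norm_neg, norm_smul, Real.norm_of_nonneg hξ'.1]
    nlinarith [hξ'.2, norm_nonneg T, hξ'.1]
  have b3 : |g x T - g (x + ξ • T) T| ≤ δ / 2 := by
    rw [← sub_apply]
    refine ((g x - g (x + ξ • T)).le_opNorm T).trans ?_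
    rw [dist_eq_norm] at b2
    nlinarith [norm_nonneg T, norm_nonneg (g x - g (x + ξ • T))]
  rw [hgu x hx, hgu _ (hin ξ hξ')] at b3
  have b4 : C' * w ≤ δ / 2 := by
    rw [lt_div_iff₀ (by positivity)] at hw3
    nlinarith
  have := abs_sub_abs_le_abs_sub (fderiv ℝ u x T) (fderiv ℝ u (x + ξ • T) T)
  linarith

lemma ee_norm (i : Fin d ⊕ Fin q) : ‖ee d q i‖ ≤ 1 := by
  rcases i with i | j
  · rw [ee_inl, Prod.norm_def]; simp
  · rw [ee_inr, Prod.norm_def]; simp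

lemma htan (hr : 0 < r) (hρ : r < ρ) {u : XX d q → ℝ} (hu : ∀ x ∈ OO d q r ρ, DifferentiableAt ℝ u x)
    {g : XX d q → (XX d q →L[ℝ] ℝ)} (hg : ContinuousOn g (closure (OO d q r ρ)))
    (hgu : ∀ x ∈ OO d q r ρ, g x = fderiv ℝ u x)
    {C : ℝ} (hC0 : 0 ≤ C) (hC : ∀ x ∈ OO d q r ρ, |u x| ≤ C * DD r ρ x)
    (c : Fin d ⊕ Fin q → XX d q → ℝ) (hc : ∀ i, BC (OO d q r ρ) (c i))
    (h0 : ∀ x ∈ OO d q r ρ, ∑ i, c i x * fderiv ℝ (DD r ρ) x (ee d q i) = 0) :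
    Sm (OO d q r ρ) (DD r ρ) (fun x => ∑ i, c i x * fderiv ℝ u x (ee d q i)) := by
  intro δ hδ
  choose hc1 B hB using hc
  set A := ∑ i, |B i| + 1 with hA
  have hA0 : 0 < A := by positivity
  obtain ⟨ε₀, h1, h2⟩ := tan_small hr hρ hu hg hgu hC0 hC (div_pos hδ hA0)
  refine ⟨ε₀, h1, fun x hx hd => ?_⟩
  set T : XX d q := ∑ i, c i x • ee d q i with hT
  have hTn : ‖T‖ ≤ A := by
    refine (norm_sum_le _ _).trans ?_
    have : ∑ i, ‖c i x • ee d q i‖ ≤ ∑ i, |B i| := by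
      refine Finset.sum_le_sum fun i _ => ?_
      rw [norm_smul]
      refine (mul_le_of_le_one_right (norm_nonneg _) (ee_norm i)).trans ((hB i x hx).trans (le_abs_self _))
    linarith
  have k := h2 x hx hd (A⁻¹ • T) (by
    rw [norm_smul, Real.norm_of_nonneg (by positivity), inv_mul_le_iff₀ hA0]; linarith) (by
    rw [map_smul, hT, map_sum]
    simp only [map_smul, smul_eq_mul]
    rw [h0 x hx, mul_zero])
  have e : fderiv ℝ u x T = ∑ i, c i x * fderiv ℝ u x (ee d q i) := by
    rw [hT, map_sum]; simp only [map_smul, smul_eq_mul]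
  rw [map_smul, e, smul_eq_mul, abs_mul, abs_of_pos (inv_pos.2 hA0), inv_mul_le_iff₀ hA0] at k
  calc _ ≤ _ := k
    _ = δ := by field_simp

end bdry
end PZ
end

open MeasureTheory

noncomputable section
set_option linter.unusedSectionVars false
set_option linter.unusedVariables false
namespace PZ
open Filter Topology Set

section vf
variable {d q : ℕ} {r ρ b : ℝ}

def Φ (d : ℕ) (b t : ℝ) : ℝ := (1 - (b / t) ^ d) / d
def VV (d q : ℕ) (b : ℝ) : Fin d ⊕ Fin q → XX d q → ℝ :=
  Sum.elim (fun i x => Φ d b ‖x.1‖ * x.1 i) (fun j x => x.2 j)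

lemma coord1 (i : Fin d) : ContDiff ℝ 2 (fun x : XX d q => x.1 i) := by
  exact (EuclideanSpace.proj i : EuclideanSpace ℝ (Fin d) →L[ℝ] ℝ).contDiff.comp contDiff_fst
lemma coord2 (j : Fin q) : ContDiff ℝ 2 (fun x : XX d q => x.2 j) := by
  exact (EuclideanSpace.proj j : EuclideanSpace ℝ (Fin q) →L[ℝ] ℝ).contDiff.comp contDiff_snd

lemma VV_cd (i : Fin d ⊕ Fin q) : ContDiffOn ℝ 2 (VV d q b i) (WW d q) := by
  rcases i with i | j
  · refine ContDiffOn.mul (ContDiffOn.div_const (contDiffOn_const.sub (ContDiffOn.pow ?_ d)) _) (coord1 i).contDiffOn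
    exact contDiffOn_const.div norm_cd (fun x hx => norm_ne_zero_iff.2 hx)
  · exact (coord2 j).contDiffOn

lemma BC_VV (hr : 0 < r) (hρ : r < ρ) (i : Fin d ⊕ Fin q) : BC (OO d q r ρ) (VV d q b i) :=
  BC.of_closure (cpt_clos hr hρ) ((VV_cd i).continuousOn.mono (clos_WW hr hρ))

lemma BC_VVd (hr : 0 < r) (hρ : r < ρ) (i : Fin d ⊕ Fin q) (v : XX d q) :
    BC (OO d q r ρ) (fun x => fderiv ℝ (VV d q b i) x v) :=
  BC.of_closure (cpt_clos hr hρ) ((c1_partial WW_open (VV_cd i) v).continuousOn.mono (clos_WW hr hρ))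

lemma Φ_deriv (hd : d ≠ 0) {t : ℝ} (ht : t ≠ 0) : HasDerivAt (Φ d b) ((b / t) ^ d / t) t := by
  have h1 : HasDerivAt (fun t => b / t) (-b / t ^ 2) t := by
    simpa [div_eq_mul_inv, neg_div] using (hasDerivAt_inv ht).const_mul b
  have h2 := ((h1.fun_pow d).const_sub 1).div_const (d : ℝ)
  refine h2.congr_deriv ?_
  have hd' : (d : ℝ) ≠ 0 := by exact_mod_cast hd
  obtain ⟨e, rfl⟩ := Nat.exists_eq_succ_of_ne_zero hd
  simp only [Nat.succ_sub_one, Nat.succ_eq_add_one, pow_succ (b / t)]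
  field_simp

lemma VV_inl (hd : d ≠ 0) {x : XX d q} (hx : x.1 ≠ 0) (i : Fin d) (v : XX d q) :
    fderiv ℝ (VV d q b (Sum.inl i)) x v =
      Φ d b ‖x.1‖ * v.1 i + (b / ‖x.1‖) ^ d / ‖x.1‖ ^ 2 * inner ℝ x.1 v.1 * x.1 i := by
  have ht : ‖x.1‖ ≠ 0 := norm_ne_zero_iff.2 hx
  have h1 : HasFDerivAt (Φ d b ∘ fun x : XX d q => ‖x.1‖) _ x := (Φ_deriv hd ht).comp_hasFDerivAt x (norm_fd hx)
  have h2 : HasFDerivAt (fun x : XX d q => x.1 i)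
      ((EuclideanSpace.proj i : EuclideanSpace ℝ (Fin d) →L[ℝ] ℝ).comp (ContinuousLinearMap.fst ℝ _ _)) x :=
    ((EuclideanSpace.proj i : EuclideanSpace ℝ (Fin d) →L[ℝ] ℝ).comp (ContinuousLinearMap.fst ℝ _ (EuclideanSpace ℝ (Fin q)))).hasFDerivAt
  have h3 : HasFDerivAt (VV d q b (Sum.inl i)) _ x := h1.fun_mul h2
  rw [h3.fderiv]
  simp
  field_simp

lemma VV_inr {x : XX d q} (j : Fin q) (v : XX d q) :
    fderiv ℝ (VV d q b (Sum.inr j)) x v = v.2 j := by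
  have h2 : HasFDerivAt (fun x : XX d q => x.2 j)
      ((EuclideanSpace.proj j : EuclideanSpace ℝ (Fin q) →L[ℝ] ℝ).comp (ContinuousLinearMap.snd ℝ _ _)) x :=
    ((EuclideanSpace.proj j : EuclideanSpace ℝ (Fin q) →L[ℝ] ℝ).comp (ContinuousLinearMap.snd ℝ (EuclideanSpace ℝ (Fin d)) _)).hasFDerivAt
  have h3 : HasFDerivAt (VV d q b (Sum.inr j)) _ x := h2
  rw [h3.fderiv]; simp

lemma VV_div (hd : d ≠ 0) {x : XX d q} (hx : x.1 ≠ 0) :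
    ∑ i, fderiv ℝ (VV d q b i) x (ee d q i) = 1 + q := by
  have ht : ‖x.1‖ ≠ 0 := norm_ne_zero_iff.2 hx
  have hd' : (d : ℝ) ≠ 0 := by exact_mod_cast hd
  rw [Fintype.sum_sum_type]
  simp only [VV_inl hd hx, VV_inr, ee_inl, ee_inr]
  have e : ∀ i : Fin d, Φ d b ‖x.1‖ * (EuclideanSpace.single i (1:ℝ)) i + (b / ‖x.1‖) ^ d / ‖x.1‖ ^ 2 *
      inner ℝ x.1 (EuclideanSpace.single i (1:ℝ)) * x.1 i =
      Φ d b ‖x.1‖ + (b / ‖x.1‖) ^ d / ‖x.1‖ ^ 2 * x.1 i ^ 2 := by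
    intro i; simp [EuclideanSpace.inner_single_right]; ring
  simp only [e, Finset.sum_add_distrib, ← Finset.mul_sum, nsq]
  simp [Φ]
  field_simp
  ring

lemma VV_quad (hd : d ≠ 0) {x : XX d q} (hx : x.1 ≠ 0) (ξ : Fin d ⊕ Fin q → ℝ) :
    ∑ i, ∑ j, fderiv ℝ (VV d q b j) x (ee d q i) * (ξ i * ξ j) =
      Φ d b ‖x.1‖ * ∑ i, ξ (Sum.inl i) ^ 2 + (b / ‖x.1‖) ^ d / ‖x.1‖ ^ 2 * (∑ i, x.1 i * ξ (Sum.inl i)) ^ 2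
        + ∑ j, ξ (Sum.inr j) ^ 2 := by
  simp only [Fintype.sum_sum_type, VV_inl hd hx, VV_inr, ee_inl, ee_inr]
  have e : ∀ i : Fin d, (∑ x_1 : Fin d, (Φ d b ‖x.1‖ * (EuclideanSpace.single i (1:ℝ)) x_1 + (b / ‖x.1‖) ^ d / ‖x.1‖ ^ 2 *
      inner ℝ x.1 (EuclideanSpace.single i (1:ℝ)) * x.1 x_1) * (ξ (Sum.inl i) * ξ (Sum.inl x_1))) =
      Φ d b ‖x.1‖ * ξ (Sum.inl i) ^ 2 + (b / ‖x.1‖) ^ d / ‖x.1‖ ^ 2 * (x.1 i * ξ (Sum.inl i)) *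
        ∑ j, x.1 j * ξ (Sum.inl j) := by
    intro i
    simp only [add_mul, Finset.sum_add_distrib, Finset.mul_sum]
    congr 1
    · rw [Finset.sum_eq_single i]
      · rw [PiLp.single_apply, if_pos rfl]; ring
      · intro j _ hj; simp [hj]
      · simp
    · refine Finset.sum_congr rfl fun j _ => ?_
      simp [EuclideanSpace.inner_single_right]; ring
  simp only [e, Finset.sum_add_distrib, ← Finset.mul_sum, ← Finset.sum_mul]
  have e2 : ∀ j : Fin q, (∑ x : Fin q, (EuclideanSpace.single j (1:ℝ)) x * (ξ (Sum.inr j) * ξ (Sum.inr x))) =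
      ξ (Sum.inr j) ^ 2 := by
    intro j
    rw [Finset.sum_eq_single j]
    · simp; ring
    · intro i _ hj; simp [hj]
    · simp
  simp only [e2]
  simp
  ring

lemma VV_quad_le (hd : d ≠ 0) (hb : 0 ≤ b) {x : XX d q} (hx : x.1 ≠ 0) (ξ : Fin d ⊕ Fin q → ℝ) :
    ∑ i, ∑ j, fderiv ℝ (VV d q b j) x (ee d q i) * (ξ i * ξ j) ≤
      ∑ i, ξ i ^ 2 - ((d : ℝ) - 1) * Φ d b ‖x.1‖ * ∑ i, ξ (Sum.inl i) ^ 2 := by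
  have ht : 0 < ‖x.1‖ := norm_pos_iff.2 hx
  have hd' : (d : ℝ) ≠ 0 := by exact_mod_cast hd
  rw [VV_quad hd hx, Fintype.sum_sum_type]
  have cs : (∑ i, x.1 i * ξ (Sum.inl i)) ^ 2 ≤ ‖x.1‖ ^ 2 * ∑ i, ξ (Sum.inl i) ^ 2 := by
    rw [← nsq]; exact Finset.sum_mul_sq_le_sq_mul_sq _ _ _
  have h1 : (b / ‖x.1‖) ^ d / ‖x.1‖ ^ 2 * (∑ i, x.1 i * ξ (Sum.inl i)) ^ 2 ≤
      (b / ‖x.1‖) ^ d / ‖x.1‖ ^ 2 * (‖x.1‖ ^ 2 * ∑ i, ξ (Sum.inl i) ^ 2) := by gcongr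
  have h2 : (b / ‖x.1‖) ^ d / ‖x.1‖ ^ 2 * (‖x.1‖ ^ 2 * ∑ i, ξ (Sum.inl i) ^ 2) =
      (b / ‖x.1‖) ^ d * ∑ i, ξ (Sum.inl i) ^ 2 := by field_simp
  have h3 : (b / ‖x.1‖) ^ d = 1 - d * Φ d b ‖x.1‖ := by unfold Φ; field_simp; ring
  rw [h2, h3] at h1
  rw [h3]
  linarith

lemma VV_D {x : XX d q} (hx : x.1 ≠ 0) :
    ∑ i, VV d q b i x * fderiv ℝ (DD r ρ) x (ee d q i) =
      -2 * ((‖x.1‖ - ρ) * (‖x.1‖ * Φ d b ‖x.1‖) + r ^ 2 - (‖x.1‖ - ρ) ^ 2 - DD r ρ x) := by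
  have ht : ‖x.1‖ ≠ 0 := norm_ne_zero_iff.2 hx
  rw [Fintype.sum_sum_type]
  simp only [DD_inl hx, DD_inr hx]
  have e1 : ∀ i : Fin d, VV d q b (Sum.inl i) x * (-2 * (‖x.1‖ - ρ) / ‖x.1‖ * x.1 i) =
    (-2 * (‖x.1‖ - ρ) / ‖x.1‖ * Φ d b ‖x.1‖) * x.1 i ^ 2 := by intro i; simp [VV]; ring
  have e2 : ∀ i : Fin q, VV d q b (Sum.inr i) x * (-2 * x.2 i) = -2 * x.2 i ^ 2 := by
    intro i; simp [VV]; ring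
  simp only [e1, e2, ← Finset.mul_sum, nsq]
  unfold DD
  field_simp
  ring

lemma Φ_pos (hd : d ≠ 0) (hb : 0 < b) {t : ℝ} (ht : b < t) : 0 < Φ d b t := by
  have hd' : (0:ℝ) < d := by exact_mod_cast Nat.pos_of_ne_zero hd
  have h1 : b / t < 1 := by rw [div_lt_one (hb.trans ht)]; exact ht
  have h2 : (b / t) ^ d < 1 := pow_lt_one₀ (div_nonneg hb.le (hb.trans ht).le) h1 hd
  exact div_pos (by linarith) hd'

lemma Φ_le (hd : d ≠ 0) (hb : 0 < b) {t : ℝ} (ht : b ≤ t) : t * Φ d b t ≤ t - b := by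
  have hd' : (0:ℝ) < d := by exact_mod_cast Nat.pos_of_ne_zero hd
  have ht0 : 0 < t := hb.trans_le ht
  have h1 : 1 + (d : ℝ) * (b / t - 1) ≤ (b / t) ^ d := by
    have := one_add_mul_le_pow (a := b / t - 1) (by have : 0 ≤ b / t := by positivity
                                                    linarith) d
    simpa using this
  have h2 : Φ d b t ≤ 1 - b / t := by
    unfold Φ; rw [div_le_iff₀ hd']; linarith
  calc t * Φ d b t ≤ t * (1 - b / t) := by gcongr
    _ = t - b := by field_simp

end vf
end PZ
end

open MeasureTheory

noncomputable section
set_option linter.unusedSectionVars false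
set_option linter.unusedVariables false
namespace PZ
open Filter Topology Set

section fin
variable {d q : ℕ} {r ρ : ℝ}

lemma y_zero (hr : 0 < r) (hρ : r < ρ) {u : XX d q → ℝ} (hu : ∀ x ∈ OO d q r ρ, DifferentiableAt ℝ u x)
    (huc : ContinuousOn u (closure (OO d q r ρ))) (hb : ∀ x ∈ frontier (OO d q r ρ), u x = 0)
    (h0 : ∀ x ∈ OO d q r ρ, ∀ i, fderiv ℝ u x (ee d q (Sum.inl i)) = 0) : ∀ x ∈ OO d q r ρ, u x = 0 := by
  have h1 : ∀ x ∈ OO d q r ρ, ∀ w, fderiv ℝ u x (w, 0) = 0 := by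
    intro x hx w
    have e : ((w, 0) : XX d q) = ∑ i, w i • ee d q (Sum.inl i) := by
      have := (EuclideanSpace.basisFun (Fin d) ℝ).sum_repr w
      refine Prod.ext ?_ ?_
      · rw [Prod.fst_sum]
        simpa [ee_inl] using this.symm
      · rw [Prod.snd_sum]; simp [ee_inl]
    rw [e, map_sum]
    exact Finset.sum_eq_zero fun i _ => by rw [map_smul, h0 x hx, smul_zero]
  intro x hx
  have hD : 0 < DD r ρ x := hx
  have hx1 : x.1 ≠ 0 := OO_WW hr hρ hx
  have ht : 0 < ‖x.1‖ := norm_pos_iff.2 hx1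
  have hD' : 0 < r ^ 2 - (‖x.1‖ - ρ) ^ 2 - ‖x.2‖ ^ 2 := hx
  set w := √(r ^ 2 - ‖x.2‖ ^ 2) with hw
  have hw0 : 0 ≤ w := Real.sqrt_nonneg _
  have hw2 : w ^ 2 = r ^ 2 - ‖x.2‖ ^ 2 := Real.sq_sqrt (by nlinarith [sq_nonneg (‖x.1‖ - ρ)])
  have hsw : |‖x.1‖ - ρ| < w := abs_lt_of_sq_lt_sq (by linarith) hw0
  rw [abs_lt] at hsw
  have hDr : ∀ σ : ℝ, 0 ≤ σ → DD r ρ (x + σ • ((‖x.1‖⁻¹ • x.1, 0) : XX d q)) = w ^ 2 - (‖x.1‖ - ρ + σ) ^ 2 := by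
    intro σ hσ
    have e1 : ‖(x + σ • ((‖x.1‖⁻¹ • x.1, 0) : XX d q)).1‖ = ‖x.1‖ + σ := by
      have : x.1 + σ • (‖x.1‖⁻¹ • x.1) = (1 + σ * ‖x.1‖⁻¹) • x.1 := by
        rw [add_smul, one_smul, smul_smul]
      simp only [Prod.fst_add, Prod.smul_fst]
      rw [this, norm_smul, Real.norm_of_nonneg (by positivity)]
      field_simp
    have e2 : (x + σ • ((‖x.1‖⁻¹ • x.1, 0) : XX d q)).2 = x.2 := by simp
    rw [DD, e1, e2, hw2]; ring
  have key := exit_bound OO_open hu huc hb (x := x) (n := (‖x.1‖⁻¹ • x.1, 0)) (M := 0)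
    (s := w - (‖x.1‖ - ρ)) (by linarith) ?_ ?_ ?_
  · rw [zero_mul] at key; exact abs_nonpos_iff.1 key
  · rintro σ ⟨hσ, hσ2⟩
    show 0 < DD r ρ _
    rw [hDr σ hσ]
    nlinarith
  · show ¬ (0 < DD r ρ _)
    rw [hDr _ (by linarith)]
    simp
  · intro y hy; rw [h1 y hy]; simp

set_option maxHeartbeats 1600000 in
lemma main (hd : d ≠ 0) (hq : 2 ≤ q) (hr : 0 < r) (hρ : r < ρ) {l lam p n : ℝ} (hn : n = 1 + q)
    (hl : ∀ ψ : XX d q → ℝ, ContDiff ℝ (⊤ : ℕ∞) ψ → HasCompactSupport ψ → tsupport ψ ⊆ OO d q r ρ →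
      l * ∫ x in OO d q r ρ, ψ x ^ 2 ≤ ∫ x in OO d q r ρ, ∑ i, fderiv ℝ ψ x (ee d q i) ^ 2)
    (hp : 2 * n / (n - 2) ≤ p) (hlam : lam ≤ 2 * (p - 2 * n / (n - 2)) / (2 * n / (n - 2) * (p - 2)) * l)
    {u : XX d q → ℝ} (hu2 : ContDiffOn ℝ 2 u (OO d q r ρ))
    (huc : ContinuousOn u (closure (OO d q r ρ)))
    {g : XX d q → XX d q →L[ℝ] ℝ} (hgc : ContinuousOn g (closure (OO d q r ρ)))
    (hgu : ∀ x ∈ OO d q r ρ, g x = fderiv ℝ u x)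
    (hpde : ∀ x ∈ OO d q r ρ, ∑ i, fderiv ℝ (fun y => fderiv ℝ u y (ee d q i)) x (ee d q i) =
      - (lam * u x + |u x| ^ (p - 2) * u x))
    (hbd : ∀ x ∈ frontier (OO d q r ρ), u x = 0) : ∀ x ∈ OO d q r ρ, u x = 0 := by
  have hcut := cut (d := d) (q := q) hr hρ
  set Ω := OO d q r ρ with hΩ
  set D : XX d q → ℝ := DD r ρ with hDdef
  have hn3 : 3 ≤ n := by
    have : (2:ℝ) ≤ q := by exact_mod_cast hq
    rw [hn]; linarith
  have hst : 2 < 2 * n / (n - 2) := by rw [lt_div_iff₀ (by linarith)]; linarith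
  have hp2 : 2 < p := hst.trans_le hp
  have du : ∀ x ∈ Ω, DifferentiableAt ℝ u x := fun x hx =>
    (hu2.contDiffAt (OO_open.mem_nhds hx)).differentiableAt two_ne_zero
  have bu : BC Ω u := BC.of_closure (cpt_clos hr hρ) huc
  have bui : ∀ i, BC Ω (fun x => fderiv ℝ u x (ee d q i)) := fun i =>
    (BC.of_closure (cpt_clos hr hρ) (hgc.clm_apply (continuousOn_const (c := ee d q i)))).congr
      fun x hx => by rw [hgu x hx]
  have bD : ∀ i, BC Ω (fun x => fderiv ℝ D x (ee d q i)) := fun i => BC_DD hr hρ _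
  obtain ⟨G, hG⟩ := (cpt_clos hr hρ).exists_bound_of_continuousOn hgc
  have hG' : ∀ x ∈ Ω, ‖fderiv ℝ u x‖ ≤ G := fun x hx => by
    rw [← hgu x hx]; exact hG x (subset_closure hx)
  obtain ⟨C, hC0, hC⟩ := u_le_D hr hρ du huc hbd hG'
  set f : ℝ → ℝ := fun s => lam * s + |s| ^ (p - 2) * s with hf
  set F : ℝ → ℝ := fun s => lam / 2 * s ^ 2 + |s| ^ p / p with hF
  have hpc : Continuous (fun s : ℝ => |s| ^ (p - 2)) :=
    continuous_abs.rpow_const fun s => Or.inr (by linarith)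
  have hpc' : Continuous (fun s : ℝ => |s| ^ p) :=
    continuous_abs.rpow_const fun s => Or.inr (by linarith)
  have fc : Continuous f := (continuous_const.mul continuous_id).add (hpc.mul continuous_id)
  have hFf : ∀ s, HasDerivAt F (f s) s := by
    intro s
    have h1 := (hasDerivAt_abs_rpow s (show 1 < p by linarith)).div_const p
    have h2 := ((hasDerivAt_id s).fun_pow 2).const_mul (lam / 2)
    refine (h2.fun_add h1).congr_deriv ?_
    have : p ≠ 0 := by linarith
    simp [hf]; field_simp
  have hFc : ContDiff ℝ 1 F := by
    rw [contDiff_one_iff_deriv]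
    refine ⟨fun s => (hFf s).differentiableAt, ?_⟩
    rw [show deriv F = f from funext fun s => (hFf s).deriv]; exact fc
  have habs : ∀ s : ℝ, |s| ^ p = |s| ^ (p - 2) * s ^ 2 := by
    intro s
    by_cases hs : s = 0
    · subst hs; simp [Real.zero_rpow (show p ≠ 0 by linarith)]
    · rw [← sq_abs, ← Real.rpow_natCast |s| 2, ← Real.rpow_add (abs_pos.2 hs)]; norm_num
  have hFs : Sm Ω D (fun x => F (u x)) := by
    have h1 := (Sm.of_le hcut.pos hC).mulBC
      (bu.comp (φ := fun s => lam / 2 * s + |s| ^ (p - 2) * s / p)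
        ((continuous_const.mul continuous_id).add ((hpc.mul continuous_id).div_const p)))
    refine h1.congr one_pos fun x hx _ => ?_
    simp only [hF, habs]; ring
  have blap : BC Ω (fun x => ∑ i, fderiv ℝ (fun y => fderiv ℝ u y (ee d q i)) x (ee d q i)) :=
    (bu.comp fc).neg.congr fun x hx => hpde x hx
  set S : XX d q → ℝ := fun x => ∑ i, fderiv ℝ u x (ee d q i) ^ 2 with hS
  have bS : BC Ω S := BC.sum _ fun i => (bui i).pow 2
  have S0 : ∀ x, 0 ≤ S x := fun x => Finset.sum_nonneg fun i _ => sq_nonneg _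
  obtain ⟨KS, hKS⟩ := bS.2
  have int : ∀ {q : XX d q → ℝ}, BC Ω q → IntegrableOn q Ω volume := fun h => h.integrableOn OO_open (OO_fin hr hρ)
  -- energy
  have hE : ∫ x in Ω, (S x - lam * u x ^ 2 - |u x| ^ p) = 0 := by
    rw [← energy hcut hu2 bu bui bD hC blap]
    refine setIntegral_congr_fun OO_open.measurableSet fun x hx => ?_
    simp only [hpde x hx, habs, hS]; ring
  have bE : BC Ω (fun x => S x - lam * u x ^ 2 - |u x| ^ p) :=
    (bS.sub ((BC.const lam).mul (bu.pow 2))).sub (bu.comp hpc')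
  have hL := lam_u hcut hl (hu2.of_le (by norm_num)) bu bD bui hC
    (fun x hx => ((DD_cd (n := 1)).contDiffAt (WW_open.mem_nhds (OO_WW hr hρ hx))).differentiableAt one_ne_zero)
  set c := 2 * (p - 2 * n / (n - 2)) / (2 * n / (n - 2) * (p - 2)) with hc
  have hc0 : 0 ≤ c := div_nonneg (by linarith) (mul_nonneg (by linarith) (by linarith))
  set α := n * (1 / 2 - 1 / p) with hα
  have hα0 : 0 ≤ α := by
    have : 1 / p ≤ 1 / 2 := one_div_le_one_div_of_le two_pos hp2.le
    exact mul_nonneg (by linarith) (by linarith)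
  have hαc : α * c = n / 2 - 1 - n / p := by
    have h1 : n - 2 ≠ 0 := by linarith
    have h2 : p - 2 ≠ 0 := by linarith
    have h3 : p ≠ 0 := by linarith
    have h4 : n ≠ 0 := by linarith
    rw [hα, hc]; field_simp
  have hA0 : 0 ≤ ∫ x in Ω, u x ^ 2 := integral_nonneg fun x => sq_nonneg _
  have hneg : α * (lam * (∫ x in Ω, u x ^ 2) - c * ∫ x in Ω, S x) ≤ 0 := by
    have h1 : lam * (∫ x in Ω, u x ^ 2) ≤ c * l * ∫ x in Ω, u x ^ 2 := by gcongr
    have h2 := mul_le_mul_of_nonneg_left hL hc0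
    have : lam * (∫ x in Ω, u x ^ 2) - c * ∫ x in Ω, S x ≤ 0 := by
      rw [← mul_assoc] at h2; linarith
    exact mul_nonpos_of_nonneg_of_nonpos hα0 this
  -- quadratic form
  have hmain : ∀ b : ℝ, ∃ Rr : XX d q → ℝ, BC Ω Rr ∧
      (∀ x ∈ Ω, Rr x = S x - ∑ i, ∑ j, fderiv ℝ (VV d q b j) x (ee d q i) *
        (fderiv ℝ u x (ee d q i) * fderiv ℝ u x (ee d q j))) ∧
      ∫ x in Ω, (∑ i, ∑ j, fderiv ℝ (VV d q b j) x (ee d q i) * (fderiv ℝ u x (ee d q i) * fderiv ℝ u x (ee d q j))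
        + (F (u x) - 1 / 2 * ∑ j, fderiv ℝ u x (ee d q j) ^ 2) * ∑ i, fderiv ℝ (VV d q b i) x (ee d q i))
      ≤ - ∫ x in Ω, Rr x := by
    intro b
    have bR : BC Ω (fun x => S x - ∑ i, ∑ j, fderiv ℝ (VV d q b j) x (ee d q i) *
        (fderiv ℝ u x (ee d q i) * fderiv ℝ u x (ee d q j))) :=
      bS.sub (BC.sum _ fun i => BC.sum _ fun j => (BC_VVd hr hρ j _).mul ((bui i).mul (bui j)))
    refine ⟨_, bR, fun x hx => rfl, ?_⟩
    set Rr : XX d q → ℝ := fun x => S x - ∑ i, ∑ j, fderiv ℝ (VV d q b j) x (ee d q i) *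
        (fderiv ℝ u x (ee d q i) * fderiv ℝ u x (ee d q j)) with hRr
    have e : ∀ x ∈ Ω, (∑ i, ∑ j, fderiv ℝ (VV d q b j) x (ee d q i) * (fderiv ℝ u x (ee d q i) * fderiv ℝ u x (ee d q j))
        + (F (u x) - 1 / 2 * ∑ j, fderiv ℝ u x (ee d q j) ^ 2) * ∑ i, fderiv ℝ (VV d q b i) x (ee d q i)) =
        - Rr x + (α * (lam * u x ^ 2 - c * S x) - n / p * (S x - lam * u x ^ 2 - |u x| ^ p)) := by
      intro x hx
      rw [VV_div hd (OO_WW hr hρ hx), ← hn]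
      have : α * (lam * u x ^ 2 - c * S x) = α * lam * u x ^ 2 - (n / 2 - 1 - n / p) * S x := by
        rw [← hαc]; ring
      rw [this]
      simp only [hRr, hF, hα, hS]
      ring
    refine (le_of_eq (setIntegral_congr_fun OO_open.measurableSet e)).trans ?_
    have i1 : IntegrableOn (fun x => lam * u x ^ 2) Ω volume := int ((BC.const lam).mul (bu.pow 2))
    have i2 : IntegrableOn (fun x => c * S x) Ω volume := int ((BC.const c).mul bS)
    have i3 : IntegrableOn (fun x => α * (lam * u x ^ 2 - c * S x)) Ω volume := (i1.sub i2).const_mul α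
    have i4 : IntegrableOn (fun x => n / p * (S x - lam * u x ^ 2 - |u x| ^ p)) Ω volume := (int bE).const_mul _
    have i5 : IntegrableOn (fun x => α * (lam * u x ^ 2 - c * S x) - n / p * (S x - lam * u x ^ 2 - |u x| ^ p)) Ω volume := i3.sub i4
    have i0 : IntegrableOn (fun x => - Rr x) Ω volume := int bR.neg
    rw [← hΩ]
    rw [integral_add i0 i5, integral_neg, integral_sub i3 i4, integral_const_mul, integral_const_mul,
      hE, integral_sub i1 i2, integral_const_mul, integral_const_mul]
    linarith
  have hpoh := fun (b : ℝ) {Q : XX d q → ℝ} (hQ : BC Ω Q) (hqV : ∃ C : ℝ, ∀ x ∈ Ω, 1 / 2 * (∑ j, fderiv ℝ u x (ee d q j) ^ 2) *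
      ∑ i, VV d q b i x * fderiv ℝ D x (ee d q i) + Q x ≤ C * D x) {δ : ℝ} (hδ : 0 < δ) =>
    pohozaev hcut (F := F) (f := f) hu2 bu bui bD hFc hFf hFs hpde (V := VV d q b)
      (fun i => ((VV_cd i).mono (OO_WW hr hρ)).of_le (by norm_num)) (fun i => BC_VV hr hρ i)
      (fun i j => BC_VVd hr hρ j _) (s₀ := 2 * r ^ 2) (ε₁ := r ^ 2 / 2) (by positivity) (by positivity)
      (fun x hx h => by rw [DD_sq (OO_WW hr hρ hx)]; linarith)
      (fun c hc h0 => htan hr hρ du hgc hgu hC0 hC c hc h0) hQ hqV.choose_spec hδ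
  by_cases hd1 : d = 1
  · obtain ⟨Rr, bR, hR, hI⟩ := hmain ρ
    have R0 : ∀ x ∈ Ω, 0 ≤ Rr x := by
      intro x hx
      rw [hR x hx]
      have := VV_quad_le hd (hr.trans hρ).le (OO_WW hr hρ hx) (fun i => fderiv ℝ u x (ee d q i))
      have h1 : ((d:ℝ) - 1) = 0 := by rw [hd1]; simp
      rw [h1, zero_mul, zero_mul, sub_zero] at this
      simp only [hS]
      linarith
    have hRi : 0 ≤ ∫ x in Ω, Rr x := setIntegral_nonneg OO_open.measurableSet R0
    have hlim : Tendsto (fun ε => ∫ x in Ω, mm r ρ ε x * ∑ i, fderiv ℝ u x (ee d q i) ^ 2) (𝓝[>] 0) (𝓝 0) := by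
      rw [Metric.tendsto_nhds]
      intro δ hδ
      have hq' : ∃ C : ℝ, ∀ x ∈ Ω, 1 / 2 * (∑ j, fderiv ℝ u x (ee d q j) ^ 2) *
          ∑ i, VV d q ρ i x * fderiv ℝ D x (ee d q i) + r ^ 2 * S x ≤ C * D x := by
        refine ⟨KS, fun x hx => ?_⟩
        have hx1 := OO_WW hr hρ hx
        have ht : ‖x.1‖ ≠ 0 := norm_ne_zero_iff.2 hx1
        rw [VV_D hx1]
        have : ‖x.1‖ * Φ d ρ ‖x.1‖ = ‖x.1‖ - ρ := by
          generalize ‖x.1‖ = t at ht ⊢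
          rw [hd1]; simp only [Φ, pow_one, Nat.cast_one, div_one]; field_simp
        rw [this]
        have h1 : S x * D x ≤ KS * D x :=
          mul_le_mul_of_nonneg_right ((le_abs_self _).trans (hKS x hx)) (hcut.pos x hx).le
        simp only [hS] at h1 ⊢
        simp only [hDdef] at h1 ⊢
        nlinarith
      filter_upwards [hpoh ρ ((BC.const (r ^ 2)).mul bS) hq' (δ := r ^ 2 * δ / 2) (by positivity), self_mem_nhdsWithin] with ε h1 hε
      have h2 : ∫ x in Ω, mm r ρ ε x * (r ^ 2 * S x) = r ^ 2 * ∫ x in Ω, mm r ρ ε x * S x := by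
        rw [← integral_const_mul]; congr 1; ext x; ring
      rw [h2] at h1
      have h3 : r ^ 2 * ∫ x in Ω, mm r ρ ε x * S x ≤ r ^ 2 * (δ / 2) := by linarith
      have h4 := le_of_mul_le_mul_left h3 (by positivity)
      have h5 : 0 ≤ ∫ x in Ω, mm r ρ ε x * S x := integral_nonneg fun x => mul_nonneg (mm_nonneg hε x) (S0 x)
      rw [Real.dist_eq, sub_zero, abs_of_nonneg h5]
      linarith
    obtain ⟨_, Kp, hKp⟩ := bu.comp hpc
    set ℓ : XX d q →L[ℝ] ℝ := (EuclideanSpace.proj (⟨0, by omega⟩ : Fin q) : EuclideanSpace ℝ (Fin q) →L[ℝ] ℝ).comp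
      (ContinuousLinearMap.snd ℝ (EuclideanSpace ℝ (Fin d)) _) with hℓ
    refine carleman hcut hu2 bu bui bD hC blap (M := |lam| + |Kp|) (by positivity) ?_ hlim ℓ
      (Sum.inr (⟨0, by omega⟩ : Fin q)) ?_ hr ?_
    · intro x hx
      rw [hpde x hx, abs_neg]
      refine (abs_add_le _ _).trans ?_
      rw [abs_mul, abs_mul, add_mul]
      exact add_le_add le_rfl (mul_le_mul_of_nonneg_right ((hKp x hx).trans (le_abs_self _)) (abs_nonneg _))
    · rintro (i | j)
      · simp [hℓ, ee_inl]
      · simp [hℓ, ee_inr, eq_comm]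
    · intro x hx
      have h1 : |x.2 (⟨0, by omega⟩ : Fin q)| ≤ ‖x.2‖ := PiLp.norm_apply_le x.2 _
      exact h1.trans (t_bound hr (le_of_lt (hcut.pos x hx))).2
  · obtain ⟨Rr, bR, hR, hI⟩ := hmain (ρ - r)
    have hb : 0 < ρ - r := by linarith
    have hd2 : (0:ℝ) < d - 1 := by
      have : 1 < d := by omega
      have : (1:ℝ) < d := by exact_mod_cast this
      linarith
    have htb : ∀ x ∈ Ω, ρ - r < ‖x.1‖ := by
      intro x hx
      have h1 : 0 < r ^ 2 - (‖x.1‖ - ρ) ^ 2 - ‖x.2‖ ^ 2 := hx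
      have : |‖x.1‖ - ρ| < r := abs_lt_of_sq_lt_sq (by nlinarith [sq_nonneg ‖x.2‖]) hr.le
      linarith [(abs_lt.1 this).1]
    have R1 : ∀ x ∈ Ω, ((d : ℝ) - 1) * Φ d (ρ - r) ‖x.1‖ * ∑ i, fderiv ℝ u x (ee d q (Sum.inl i)) ^ 2 ≤ Rr x := by
      intro x hx
      rw [hR x hx]
      have := VV_quad_le hd hb.le (OO_WW hr hρ hx) (fun i => fderiv ℝ u x (ee d q i))
      exact (le_sub_comm.1 this)
    have R2 : ∀ x ∈ Ω, 0 < ((d : ℝ) - 1) * Φ d (ρ - r) ‖x.1‖ := fun x hx =>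
      mul_pos hd2 (Φ_pos hd hb (htb x hx))
    have R0 : ∀ x ∈ Ω, 0 ≤ Rr x := fun x hx =>
      (mul_nonneg (R2 x hx).le (Finset.sum_nonneg fun i _ => sq_nonneg _)).trans (R1 x hx)
    have hq' : ∃ C : ℝ, ∀ x ∈ Ω, 1 / 2 * (∑ j, fderiv ℝ u x (ee d q j) ^ 2) *
        ∑ i, VV d q (ρ - r) i x * fderiv ℝ D x (ee d q i) + 0 ≤ C * D x := by
      refine ⟨KS, fun x hx => ?_⟩
      have hx1 := OO_WW hr hρ hx
      rw [VV_D hx1, add_zero]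
      have h1 : S x * D x ≤ KS * D x :=
        mul_le_mul_of_nonneg_right ((le_abs_self _).trans (hKS x hx)) (hcut.pos x hx).le
      have hsr := abs_le.1 (t_bound hr (le_of_lt (hcut.pos x hx))).1
      have h2 : 0 ≤ (‖x.1‖ - ρ) * (‖x.1‖ * Φ d (ρ - r) ‖x.1‖) + r ^ 2 - (‖x.1‖ - ρ) ^ 2 := by
        have p1 := Φ_le hd hb (htb x hx).le
        have p2 : 0 ≤ ‖x.1‖ * Φ d (ρ - r) ‖x.1‖ := mul_nonneg (norm_nonneg _) (Φ_pos hd hb (htb x hx)).le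
        generalize ‖x.1‖ * Φ d (ρ - r) ‖x.1‖ = w at p1 p2 ⊢
        rcases le_total 0 (‖x.1‖ - ρ) with h | h
        · nlinarith
        · nlinarith
      have h3 := mul_nonneg (S0 x) h2
      simp only [hS] at h1 h3 ⊢
      simp only [hDdef] at h1 ⊢
      nlinarith
    have hQ : 0 ≤ - ∫ x in Ω, Rr x := by
      refine le_of_forall_pos_le_add fun δ hδ => ?_
      obtain ⟨ε, h1⟩ := (hpoh (ρ - r) (BC.const 0) hq' hδ).exists
      simp only [mul_zero, integral_zero] at h1
      linarith
    have hz := zero_of_int OO_open bR.1 (int bR) R0 (by linarith)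
    refine y_zero hr hρ du huc hbd fun x hx i => ?_
    have h1 := R1 x hx
    rw [hz x hx] at h1
    have h2 : ∑ i, fderiv ℝ u x (ee d q (Sum.inl i)) ^ 2 ≤ 0 := nonpos_of_mul_nonpos_right h1 (R2 x hx)
    have h3 : fderiv ℝ u x (ee d q (Sum.inl i)) ^ 2 ≤ ∑ i, fderiv ℝ u x (ee d q (Sum.inl i)) ^ 2 :=
      Finset.single_le_sum (f := fun i => fderiv ℝ u x (ee d q (Sum.inl i)) ^ 2) (fun i _ => sq_nonneg _) (Finset.mem_univ i)
    exact pow_eq_zero_iff two_ne_zero |>.1 (le_antisymm (h3.trans h2) (sq_nonneg _))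

end fin
end PZ
end


/-- nonexistence of nontrivial solutions of
`−Δu = λu + |u|^{p−2}u` in `Ω`, `u = 0` on `∂Ω`, where
`Ω = {(y,z) : (|y|,z) ∈ Θ}`, `Θ` is the ball of radius `r` centered at `(ρ,0,…,0)` with
`0 < r < ρ`, `p ≥ 2*_{N,k} = 2(N−k)/(N−k−2)` and
`λ ≤ (2(p−2*_{N,k})/(2*_{N,k}(p−2)))·λ₁(Ω)`. -/
theorem stmt_15 (k N : ℕ) (hk : k + 3 ≤ N) (r ρ : ℝ) (hr : 0 < r) (hrρ : r < ρ)
    (Ω : Set (EuclideanSpace ℝ (Fin (k + 1)) × EuclideanSpace ℝ (Fin (N - k - 1))))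
    (hΩ : Ω = {q : EuclideanSpace ℝ (Fin (k + 1)) × EuclideanSpace ℝ (Fin (N - k - 1)) |
      (‖q.1‖ - ρ) ^ 2 + ‖q.2‖ ^ 2 < r ^ 2})
    (lam₁ : ℝ)
    (hlam₁ : lam₁ = sInf { s : ℝ |
      ∃ w : EuclideanSpace ℝ (Fin (k + 1)) × EuclideanSpace ℝ (Fin (N - k - 1)) → ℝ,
        IsTestFun Ω w ∧ w ≠ 0 ∧
        s = (∫ x in Ω, gradSq k N w x) / ∫ x in Ω, w x ^ 2 })
    (p : ℝ) (hp : 2 * ((N : ℝ) - k) / ((N : ℝ) - k - 2) ≤ p)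
    (lam : ℝ)
    (hlam : lam ≤ 2 * (p - 2 * ((N : ℝ) - k) / ((N : ℝ) - k - 2)) /
        (2 * ((N : ℝ) - k) / ((N : ℝ) - k - 2) * (p - 2)) * lam₁)
    (u : EuclideanSpace ℝ (Fin (k + 1)) × EuclideanSpace ℝ (Fin (N - k - 1)) → ℝ)
    (hu2 : ContDiffOn ℝ 2 u Ω)
    (hucont : ContinuousOn u (closure Ω))
    (g : EuclideanSpace ℝ (Fin (k + 1)) × EuclideanSpace ℝ (Fin (N - k - 1)) →
      (EuclideanSpace ℝ (Fin (k + 1)) × EuclideanSpace ℝ (Fin (N - k - 1))) →L[ℝ] ℝ)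
    (hgcont : ContinuousOn g (closure Ω))
    (hgu : ∀ x ∈ Ω, g x = fderiv ℝ u x)
    (hpde : ∀ x ∈ Ω, -lap k N u x = lam * u x + |u x| ^ (p - 2) * u x)
    (hbd : ∀ x ∈ frontier Ω, u x = 0) :
    ∀ x ∈ Ω, u x = 0 := by
  have hq1 : 1 + ((N - k - 1 : ℕ) : ℝ) = (N : ℝ) - k := by
    rw [Nat.cast_sub (by omega), Nat.cast_sub (by omega)]; push_cast; ring
  have hO : Ω = PZ.OO (k + 1) (N - k - 1) r ρ := by
    rw [hΩ]; ext x
    simp only [PZ.OO, PZ.DD, Set.mem_setOf_eq]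
    constructor <;> intro h <;> linarith
  clear hΩ
  subst hO
  have hgs : ∀ w x, gradSq k N w x = ∑ i, fderiv ℝ w x (PZ.ee (k + 1) (N - k - 1) i) ^ 2 := by
    intro w x
    rw [Fintype.sum_sum_type]; rfl
  have hgn : ∀ w x, 0 ≤ gradSq k N w x := fun w x => by
    rw [hgs]; exact Finset.sum_nonneg fun i _ => sq_nonneg _
  refine PZ.main (d := k + 1) (q := N - k - 1) (l := lam₁) (lam := lam) (p := p) (n := (N : ℝ) - k)
    (Nat.succ_ne_zero k) (by omega) hr hrρ hq1.symm ?_ hp hlam hu2 hucont hgcont hgu ?_ hbd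
  · intro ψ h1 h2 h3
    simp only [← hgs]
    have hA : 0 ≤ ∫ x in PZ.OO (k + 1) (N - k - 1) r ρ, ψ x ^ 2 := integral_nonneg fun x => sq_nonneg _
    rcases hA.eq_or_lt with h | h
    · rw [← h, mul_zero]; exact integral_nonneg fun x => hgn ψ x
    · rw [← le_div_iff₀ h, hlam₁]
      refine csInf_le ⟨0, ?_⟩ ⟨ψ, ⟨h1, h2, h3⟩, ?_, rfl⟩
      · rintro _ ⟨w, -, -, rfl⟩
        exact div_nonneg (integral_nonneg fun x => hgn w x) (integral_nonneg fun x => sq_nonneg _)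
      · rintro rfl
        simp at h
  · intro x hx
    rw [← hpde x hx, neg_neg, Fintype.sum_sum_type]; rfl

end
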